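/- arXiv:1507.01481 — 2 statements merged into one kernel-verified Lean document; each statement's English description precedes it below -/
import Mathlib

section
/- Let n ≥ 3 be an integer, let K be a convex body in ℝ² with n-fold rotational symmetry about the origin o, let R_n be a regular n-gon, and suppose |K|·|K*| ≤ (1+ε)·n²·sin²(π/n) for some ε > 0. Then δ^s_BM(K,R_n) ≤ 1 + 18ε. -/
open MeasureTheory Pointwise Real
open scoped RealInnerProductSpace

/-- Area (two-dimensional Lebesgue measure) of a subset of the plane `ℂ ≅ ℝ²`. -/
noncomputable def area (K : Set ℂ) : ℝ := (volume K).toReal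

/-- The polar body `K* = {x : ⟨x,y⟩ ≤ 1 for all y ∈ K}`. -/
def polarBody (K : Set ℂ) : Set ℂ := {x | ∀ y ∈ K, ⟪x, y⟫ ≤ 1}

/-- A convex body: a compact convex set with nonempty interior. -/
def IsConvexBody (K : Set ℂ) : Prop := Convex ℝ K ∧ IsCompact K ∧ (interior K).Nonempty

/-- The `n` equally spaced points on the circle of centre `z` determined by `z + w`. -/
noncomputable def ngonVertices (n : ℕ) (z w : ℂ) : Set ℂ :=
  Set.range fun k : Fin n => z + w * Complex.exp (2 * π * Complex.I * ((k : ℕ) : ℂ) / n)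

/-- `K` is the regular `n`-gon with centre `z` whose vertices are the `n` equally
spaced points on the circle of centre `z` through `z + w`. -/
def IsRegularNgon (n : ℕ) (z w : ℂ) (K : Set ℂ) : Prop :=
  w ≠ 0 ∧ K = convexHull ℝ (ngonVertices n z w)

/-- `K` has `n`-fold rotational symmetry about the origin. -/
def HasNFoldSymmetry (n : ℕ) (K : Set ℂ) : Prop :=
  Complex.exp (2 * π * Complex.I / n) • K = K

/-- A similarity transformation of the plane: `z ↦ a z + b` or `z ↦ a z̄ + b`
with `a ≠ 0`. -/
def IsSimilarity (A : ℂ → ℂ) : Prop :=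
  ∃ a b : ℂ, a ≠ 0 ∧ ((A = fun z => a * z + b) ∨ (A = fun z => a * (starRingEnd ℂ) z + b))

/-- The analogue of the Banach–Mazur distance with similarity transformations in
place of affine ones:
`inf {λ₂/λ₁ : ∃ similarity A and x with λ₁·A(K) ⊆ L ⊆ λ₂·A(K) + x}`. -/
noncomputable def distBMsim (K L : Set ℂ) : ℝ :=
  sInf {r : ℝ | ∃ (l1 l2 : ℝ) (A : ℂ → ℂ) (x : ℂ), 0 < l1 ∧ 0 < l2 ∧ IsSimilarity A ∧
    r = l2 / l1 ∧ l1 • (A '' K) ⊆ L ∧ L ⊆ x +ᵥ l2 • (A '' K)}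

namespace Complex

/-- The planar cross product of two complex numbers. -/
def cross (z w : ℂ) : ℝ := z.re * w.im - z.im * w.re

/-- The open cone spanned by `A` and `B`, when `B` lies counterclockwise of `A`. -/
def sector (A B : ℂ) : Set ℂ := {z | 0 < cross A z ∧ 0 < cross z B}

lemma real_inner_eq (z w : ℂ) : ⟪z, w⟫ = z.re * w.re + z.im * w.im := by
  simp [Complex.inner, mul_comm]

@[fun_prop]
lemma continuous_cross_right (A : ℂ) : Continuous fun z => cross A z := by
  unfold cross; fun_prop

@[fun_prop]
lemma continuous_cross_left (B : ℂ) : Continuous fun z => cross z B := by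
  unfold cross; fun_prop

lemma isOpen_sector (A B : ℂ) : IsOpen (sector A B) :=
  (isOpen_lt continuous_const (continuous_cross_right A)).inter
    (isOpen_lt continuous_const (continuous_cross_left B))

lemma sector_smul_right {A B : ℂ} {r : ℝ} (hr : 0 < r) : sector A (r * B) = sector A B := by
  ext z
  have : cross z (r * B) = r * cross z B := by simp [cross]; ring
  simp [sector, this, hr]

lemma sector_smul_left {A B : ℂ} {r : ℝ} (hr : 0 < r) : sector (r * A) B = sector A B := by
  ext z
  have : cross (r * A) z = r * cross A z := by simp [cross]; ring
  simp [sector, this, hr]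

lemma cross_mul_mul (c z w : ℂ) : cross (c * z) (c * w) = ‖c‖ ^ 2 * cross z w := by
  rw [← normSq_eq_norm_sq, normSq_apply]
  simp [cross]; ring

lemma area_smul (c : ℂ) (L : Set ℂ) : area (c • L) = ‖c‖ ^ 2 * area L := by
  have h : c • L = (LinearMap.mulLeft ℝ c) '' L := by
    ext z; simp [Set.mem_smul_set]
  have hd : LinearMap.det (LinearMap.mulLeft ℝ c) = ‖c‖ ^ 2 := by
    rw [← normSq_eq_norm_sq, ← LinearMap.det_toMatrix basisOneI, Matrix.det_fin_two]
    simp [LinearMap.toMatrix_apply, normSq_apply]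
  rw [area, h, Measure.addHaar_image_linearMap, hd, ENNReal.toReal_mul, area,
    ENNReal.toReal_ofReal (abs_nonneg _), abs_of_nonneg (by positivity)]

lemma volume_unit_triangle :
    volume {z : ℂ | 0 < z.re ∧ 0 < z.im ∧ z.re + z.im < 1} = ENNReal.ofReal (1 / 2) := by
  have h : {z : ℂ | 0 < z.re ∧ 0 < z.im ∧ z.re + z.im < 1} =
      measurableEquivRealProd ⁻¹'
        (regionBetween (fun _ => (0 : ℝ)) (fun x => 1 - x) (Set.Ioo 0 1)) := by
    ext z
    simp only [Set.mem_ofPred_eq, Set.mem_preimage, regionBetween, measurableEquivRealProd_apply,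
      Set.mem_Ioo]
    constructor
    · rintro ⟨h1, h2, h3⟩; exact ⟨⟨h1, by linarith⟩, h2, by linarith⟩
    · rintro ⟨⟨h1, h2⟩, h3, h4⟩; exact ⟨h1, h3, by linarith⟩
  have hm : MeasurableSet
      (regionBetween (fun _ => (0 : ℝ)) (fun x => 1 - x) (Set.Ioo 0 1)) :=
    measurableSet_regionBetween (by fun_prop) (by fun_prop) measurableSet_Ioo
  rw [h, volume_preserving_equiv_real_prod.measure_preimage hm.nullMeasurableSet,
    Measure.volume_eq_prod,
    volume_regionBetween_eq_integral (by simp)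
      ((Continuous.integrableOn_Icc (by fun_prop)).mono_set Set.Ioo_subset_Icc_self)
      measurableSet_Ioo (fun x hx => by linarith [hx.2])]
  congr 1
  have : ∫ y in Set.Ioo (0 : ℝ) 1, ((fun x => 1 - x) - fun _ => (0 : ℝ) : ℝ → ℝ) y =
      ∫ y in (0 : ℝ)..1, (1 - y) := by
    rw [intervalIntegral.integral_of_le zero_le_one, integral_Ioc_eq_integral_Ioo]
    simp
  rw [this, intervalIntegral.integral_sub (by simp) (by simp), intervalIntegral.integral_const,
    integral_id]
  norm_num

/-- The open triangle with vertices `0`, `A` and `B`. -/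
def openTriangle (A B : ℂ) : Set ℂ :=
  {z | ∃ s t : ℝ, 0 < s ∧ 0 < t ∧ s + t < 1 ∧ z = s * A + t * B}

lemma area_openTriangle {A B : ℂ} (h : 0 ≤ cross A B) :
    volume (openTriangle A B) = ENNReal.ofReal (cross A B / 2) := by
  let M : ℂ →ₗ[ℝ] ℂ := basisOneI.constr ℝ ![A, B]
  have hM : ∀ z : ℂ, M z = z.re * A + z.im * B := by
    intro z; simp [M, Module.Basis.constr_apply_fintype]
  have hd : LinearMap.det M = cross A B := by
    rw [← LinearMap.det_toMatrix basisOneI, Matrix.det_fin_two]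
    simp [LinearMap.toMatrix_apply, hM, cross]; ring
  have hi : openTriangle A B = M '' {z : ℂ | 0 < z.re ∧ 0 < z.im ∧ z.re + z.im < 1} := by
    ext z
    constructor
    · rintro ⟨s, t, hs, ht, hst, rfl⟩
      exact ⟨⟨s, t⟩, ⟨hs, ht, hst⟩, by rw [hM]⟩
    · rintro ⟨y, ⟨h1, h2, h3⟩, rfl⟩
      exact ⟨y.re, y.im, h1, h2, h3, hM y⟩
  rw [hi, Measure.addHaar_image_linearMap, hd, volume_unit_triangle,
    ← ENNReal.ofReal_mul (abs_nonneg _), abs_of_nonneg h]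
  congr 1; ring

lemma isOpen_openTriangle {A B : ℂ} (h : 0 < cross A B) : IsOpen (openTriangle A B) := by
  have : openTriangle A B =
      {z | 0 < cross A z ∧ 0 < cross z B ∧ cross A z + cross z B < cross A B} := by
    ext z
    constructor
    · rintro ⟨s, t, hs, ht, hst, rfl⟩
      have h1 : cross A (s * A + t * B) = t * cross A B := by simp [cross]; ring
      have h2 : cross (s * A + t * B) B = s * cross A B := by simp [cross]; ring
      simp only [Set.mem_ofPred_eq, h1, h2]
      exact ⟨by positivity, by positivity, by nlinarith⟩
    · rintro ⟨h1, h2, h3⟩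
      refine ⟨cross z B / cross A B, cross A z / cross A B, by positivity, by positivity, ?_, ?_⟩
      · rw [← add_div, div_lt_one h]; linarith
      · have := h.ne'
        apply Complex.ext <;> simp <;> field_simp <;> simp [cross] <;> ring
  rw [this]
  exact (isOpen_lt continuous_const (continuous_cross_right A)).inter
    ((isOpen_lt continuous_const (continuous_cross_left B)).inter
      (isOpen_lt ((continuous_cross_right A).add (continuous_cross_left B)) continuous_const))

lemma openTriangle_subset {L : Set ℂ} (hL : Convex ℝ L) (h0 : (0 : ℂ) ∈ L) {A B : ℂ}
    (hA : A ∈ L) (hB : B ∈ L) : openTriangle A B ⊆ L := by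
  rintro z ⟨s, t, hs, ht, hst, rfl⟩
  have := hL.sum_mem (t := Finset.univ) (w := ![1 - s - t, s, t]) (z := ![0, A, B])
    (by intro i _; fin_cases i <;> simp <;> linarith)
    (by simp [Fin.sum_univ_three]; ring)
    (by intro i _; fin_cases i <;> simp [h0, hA, hB])
  simpa [Fin.sum_univ_three] using this

/-- If `A` and `B` are the farthest points of `L` in their directions, twice the area of `L` in the
cone spanned by `A` and `B` bounds the functional constant on the line `AB`, on all of `L`. -/
lemma cross_sub_le {L : Set ℂ} (hL : Convex ℝ L) (h0 : (0 : ℂ) ∈ L) (hfin : volume L ≠ ⊤)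
    {A B : ℂ} (hAB : 0 < cross A B) (hA : A ∈ L) (hB : B ∈ L)
    (hA1 : ∀ t : ℝ, (t : ℂ) * A ∈ L → t ≤ 1) (hB1 : ∀ t : ℝ, (t : ℂ) * B ∈ L → t ≤ 1)
    {x : ℂ} (hx : x ∈ L) : cross x (B - A) ≤ 2 * area (L ∩ sector A B) := by
  have hne := hAB.ne'
  have hfin' : volume (L ∩ sector A B) ≠ ⊤ := measure_ne_top_of_subset Set.inter_subset_left hfin
  have key : ∀ {s : Set ℂ} {u : ℝ}, 0 ≤ u → s ⊆ L ∩ sector A B → volume s = ENNReal.ofReal u →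
      u ≤ area (L ∩ sector A B) := by
    intro s u hu hs h
    have := ENNReal.toReal_mono hfin' (measure_mono hs)
    rwa [h, ENNReal.toReal_ofReal hu] at this
  obtain ⟨s, t, hst⟩ : ∃ s t : ℝ, x = s * A + t * B := by
    refine ⟨cross x B / cross A B, cross A x / cross A B, ?_⟩
    apply Complex.ext <;> simp <;> field_simp <;> simp [cross] <;> ring
  have hval : cross x (B - A) = (s + t) * cross A B := by rw [hst]; simp [cross]; ring
  have h1 : cross A x = t * cross A B := by rw [hst]; simp [cross]; ring
  have h2 : cross x B = s * cross A B := by rw [hst]; simp [cross]; ring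
  by_cases hle : s + t ≤ 1
  · have := key (by positivity) (Set.subset_inter (openTriangle_subset hL h0 hA hB) ?_)
      (area_openTriangle hAB.le)
    · rw [hval]; nlinarith
    · rintro z ⟨p, q, hp, hq, -, rfl⟩
      have h1 : cross A (p * A + q * B) = q * cross A B := by simp [cross]; ring
      have h2 : cross (p * A + q * B) B = p * cross A B := by simp [cross]; ring
      exact ⟨by rw [h1]; positivity, by rw [h2]; positivity⟩
  push Not at hle
  have hs : 0 < s := by
    by_contra! hs
    have h3 : (0 : ℝ) < 1 - s := by linarith
    have := hL hA hx (a := -s / (1 - s)) (b := 1 / (1 - s)) (div_nonneg (by linarith) h3.le)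
      (by positivity) (by field_simp; ring)
    have := hB1 (t / (1 - s)) (by
      convert this using 1
      have : (1 - (s : ℂ)) ≠ 0 := by exact_mod_cast h3.ne'
      rw [hst]; simp only [real_smul]; push_cast; field_simp; ring)
    rw [div_le_one h3] at this
    linarith
  have ht : 0 < t := by
    by_contra! ht
    have h3 : (0 : ℝ) < 1 - t := by linarith
    have := hL hB hx (a := -t / (1 - t)) (b := 1 / (1 - t)) (div_nonneg (by linarith) h3.le)
      (by positivity) (by field_simp; ring)
    have := hA1 (s / (1 - t)) (by
      convert this using 1
      have : (1 - (t : ℂ)) ≠ 0 := by exact_mod_cast h3.ne'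
      rw [hst]; simp only [real_smul]; push_cast; field_simp; ring)
    rw [div_le_one h3] at this
    linarith
  have hAx : 0 < cross A x := by rw [h1]; positivity
  have hxB : 0 < cross x B := by rw [h2]; positivity
  have hdisj : Disjoint (openTriangle A x) (openTriangle x B) := by
    rw [Set.disjoint_left]
    rintro z ⟨p, q, hp, hq, -, rfl⟩ ⟨p', q', hp', hq', -, h⟩
    have e1 : cross x (p * A + q * x) = -(p * cross A x) := by simp [cross]; ring
    have e2 : cross x (p' * x + q' * B) = q' * cross x B := by simp [cross]; ring
    have := mul_pos hp hAx
    have := mul_pos hq' hxB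
    rw [h] at e1
    linarith
  have := key (s := openTriangle A x ∪ openTriangle x B) (u := cross A x / 2 + cross x B / 2)
    (by positivity) ?_ ?_
  · rw [hval]; rw [h1, h2] at this; linarith
  · refine Set.union_subset (Set.subset_inter (openTriangle_subset hL h0 hA hx) ?_)
      (Set.subset_inter (openTriangle_subset hL h0 hx hB) ?_)
    · rintro z ⟨p, q, hp, hq, -, rfl⟩
      have h3 : cross A (p * A + q * x) = q * cross A x := by simp [cross]; ring
      have h4 : cross (p * A + q * x) B = p * cross A B + q * cross x B := by simp [cross]; ring
      exact ⟨by rw [h3]; positivity, by rw [h4]; positivity⟩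
    · rintro z ⟨p, q, hp, hq, -, rfl⟩
      have h3 : cross A (p * x + q * B) = p * cross A x + q * cross A B := by simp [cross]; ring
      have h4 : cross (p * x + q * B) B = p * cross x B := by simp [cross]; ring
      exact ⟨by rw [h3]; positivity, by rw [h4]; positivity⟩
  · rw [measure_union hdisj (isOpen_openTriangle hxB).measurableSet, area_openTriangle hAx.le,
      area_openTriangle hxB.le, ← ENNReal.ofReal_add (by positivity) (by positivity)]

lemma cross_exp_exp (α β : ℝ) : cross (exp (α * I)) (exp (β * I)) = Real.sin (β - α) := by
  simp [cross, exp_ofReal_mul_I_re, exp_ofReal_mul_I_im, Real.sin_sub]; ring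

/-- The `j`-th of `N` congruent open sectors dividing the plane. -/
noncomputable def regularSector (N j : ℕ) : Set ℂ :=
  sector (exp ((2 * π / N * j : ℝ) * I)) (exp ((2 * π / N * (j + 1) : ℝ) * I))

lemma disjoint_regularSector {N i j : ℕ} (hN : 3 ≤ N) (hij : i < j) (hj : j < N) :
    Disjoint (regularSector N i) (regularSector N j) := by
  have hN0 : (0 : ℝ) < N := by positivity
  obtain ⟨α, hα⟩ : ∃ α : ℝ, α = 2 * π / N := ⟨_, rfl⟩
  have hα0 : 0 < α := by rw [hα]; positivity
  have hαN : α * N = 2 * π := by rw [hα]; field_simp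
  have hαπ : α < π := by
    have : (3 : ℝ) ≤ N := by exact_mod_cast hN
    nlinarith [pi_pos]
  rw [Set.disjoint_left]
  intro z hz hz'
  simp only [regularSector, sector, Set.mem_ofPred_eq, ← hα] at hz hz'
  obtain ⟨ψ, hψ0, hψ1, hψ⟩ : ∃ ψ : ℝ, 0 ≤ ψ ∧ ψ < 2 * π ∧
      z = (‖z‖ : ℝ) * exp ((ψ + α * i : ℝ) * I) := by
    have hm := toIcoMod_mem_Ico Real.two_pi_pos 0 (arg z - α * i)
    refine ⟨_, hm.1, by simpa using hm.2, ?_⟩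
    rw [toIcoMod]
    conv_lhs => rw [← norm_mul_exp_arg_mul_I z]
    congr 1
    rw [exp_eq_exp_iff_exists_int]
    refine ⟨toIcoDiv Real.two_pi_pos 0 (arg z - α * i), ?_⟩
    push_cast
    simp only [zsmul_eq_mul]
    ring
  have hn := norm_nonneg z
  generalize ‖z‖ = ρ at hψ hn
  have hc1 : ∀ β : ℝ, cross (exp (β * I)) z = ρ * Real.sin (ψ + α * i - β) := by
    intro β
    rw [← cross_exp_exp, hψ]
    simp [cross]; ring
  have hc2 : ∀ β : ℝ, cross z (exp (β * I)) = ρ * Real.sin (β - (ψ + α * i)) := by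
    intro β
    rw [← cross_exp_exp, hψ]
    simp [cross]; ring
  rw [hc1, hc2] at hz hz'
  have a1 := pos_of_mul_pos_right hz.1 hn
  have a2 := pos_of_mul_pos_right hz.2 hn
  have a3 := pos_of_mul_pos_right hz'.1 hn
  have a4 := pos_of_mul_pos_right hz'.2 hn
  have hij' : (i : ℝ) + 1 ≤ j := by exact_mod_cast hij
  have hj' : (j : ℝ) + 1 ≤ N := by exact_mod_cast hj
  have hψπ : ψ < π := by
    by_contra! h
    have := Real.sin_nonpos_of_nonpos_of_neg_pi_le (x := ψ - 2 * π) (by linarith) (by linarith)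
    rw [Real.sin_sub_two_pi] at this
    rw [show ψ + α * i - α * i = ψ by ring] at a1
    linarith
  have hψα : ψ < α := by
    by_contra! h
    have := Real.sin_nonpos_of_nonpos_of_neg_pi_le (x := α * (i + 1) - (ψ + α * i))
      (by linarith) (by linarith)
    linarith
  have b1 : α * i + α ≤ α * j := by nlinarith
  have b2 : α * j + α ≤ 2 * π := by nlinarith
  have b3 : π < α * j - α * i - ψ := by
    by_contra! h
    have := Real.sin_nonpos_of_nonpos_of_neg_pi_le (x := ψ + α * i - α * j)
      (by linarith) (by linarith)
    linarith
  have b4 : 0 ≤ α * i := by positivity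
  have := Real.sin_nonpos_of_nonpos_of_neg_pi_le (x := α * (j + 1) - (ψ + α * i) - 2 * π)
    (by linarith) (by linarith)
  rw [Real.sin_sub_two_pi] at this
  linarith

lemma sum_area_inter_regularSector_le {L : Set ℂ} (hL : MeasurableSet L) (hfin : volume L ≠ ⊤)
    {N : ℕ} (hN : 3 ≤ N) :
    ∑ j ∈ Finset.range N, area (L ∩ regularSector N j) ≤ area L := by
  have hd : Set.PairwiseDisjoint (Finset.range N : Set ℕ) fun j => L ∩ regularSector N j := by
    intro i hi j hj hij
    simp only [Finset.coe_range, Set.mem_Iio] at hi hj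
    refine Disjoint.mono Set.inter_subset_right Set.inter_subset_right ?_
    rcases lt_or_gt_of_ne hij with h | h
    · exact disjoint_regularSector hN h hj
    · exact (disjoint_regularSector hN h hi).symm
  have := measure_biUnion_finset (μ := volume) hd
    (fun j _ => hL.inter (isOpen_sector _ _).measurableSet)
  unfold area
  rw [← ENNReal.toReal_sum fun j _ => measure_ne_top_of_subset Set.inter_subset_left hfin, ← this]
  exact ENNReal.toReal_mono hfin (measure_mono (by simp))

lemma area_inter_sector_rotate {L : Set ℂ} {ζ : ℂ} (hζ : ‖ζ‖ = 1) (hL : ζ • L = L) (A B : ℂ) :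
    area (L ∩ sector (ζ * A) (ζ * B)) = area (L ∩ sector A B) := by
  have h0 : ζ ≠ 0 := by rintro rfl; simp at hζ
  have : L ∩ sector (ζ * A) (ζ * B) = ζ • (L ∩ sector A B) := by
    rw [Set.smul_set_inter₀ h0, hL]
    congr 1
    ext z
    rw [Set.mem_smul_set_iff_inv_smul_mem₀ h0]
    have hz : z = ζ * (ζ⁻¹ * z) := by field_simp
    conv_lhs => rw [hz]
    simp [sector, cross_mul_mul, hζ]
  rw [this, area_smul, hζ]; ring

lemma area_inter_regularSector_add {L : Set ℂ} {N k : ℕ}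
    (hL : exp (2 * π * I / N * k) • L = L) (j : ℕ) :
    area (L ∩ regularSector N (j + k)) = area (L ∩ regularSector N j) := by
  unfold regularSector
  rw [← area_inter_sector_rotate (ζ := exp (2 * π * I / N * k)) _ hL
      (exp ((2 * π / N * j : ℝ) * I)),
    ← exp_add, ← exp_add]
  · congr 4 <;> push_cast <;> ring
  · rw [show 2 * π * I / N * k = ((2 * π / N * k : ℝ) : ℂ) * I by push_cast; ring]
    exact norm_exp_ofReal_mul_I _

lemma card_mul_area_sector_le {L : Set ℂ} (hL : MeasurableSet L) (hfin : volume L ≠ ⊤)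
    {n : ℕ} (hn : 3 ≤ n) (hsym : HasNFoldSymmetry n L) :
    n * area (L ∩ sector 1 (exp (2 * π * I / n))) ≤ area L := by
  have hf : ∀ j, area (L ∩ regularSector n j) = area (L ∩ regularSector n 0) := by
    intro j
    induction j with
    | zero => rfl
    | succ j ih => rw [area_inter_regularSector_add (by simpa [HasNFoldSymmetry] using hsym), ih]
  have := sum_area_inter_regularSector_le hL hfin hn
  simp only [hf, Finset.sum_const, Finset.card_range, nsmul_eq_mul] at this
  convert this using 4
  unfold regularSector
  congr 1
  · simp
  · congr 1; push_cast; ring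

lemma card_mul_area_half_sectors_le {L : Set ℂ} (hL : MeasurableSet L) (hfin : volume L ≠ ⊤)
    {n : ℕ} (hn : 3 ≤ n) (hsym : HasNFoldSymmetry n L) :
    n * (area (L ∩ sector 1 (exp (π * I / n))) +
      area (L ∩ sector (exp (π * I / n)) (exp (2 * π * I / n)))) ≤ area L := by
  have hn0 : (n : ℂ) ≠ 0 := by exact_mod_cast (by omega : n ≠ 0)
  have hf : ∀ j, area (L ∩ regularSector (2 * n) (j + 2)) = area (L ∩ regularSector (2 * n) j) :=
    area_inter_regularSector_add (by
      unfold HasNFoldSymmetry at hsym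
      convert hsym using 3
      push_cast; field_simp)
  have hsum : ∀ k, ∑ j ∈ Finset.range (2 * k), area (L ∩ regularSector (2 * n) j) =
      k * (area (L ∩ regularSector (2 * n) 0) + area (L ∩ regularSector (2 * n) 1)) := by
    have he : ∀ k, area (L ∩ regularSector (2 * n) (2 * k)) =
          area (L ∩ regularSector (2 * n) 0) ∧
        area (L ∩ regularSector (2 * n) (2 * k + 1)) = area (L ∩ regularSector (2 * n) 1) := by
      intro k
      induction k with
      | zero => simp
      | succ k ih =>
        exact ⟨by rw [mul_add, mul_one, hf, ih.1],
          by rw [show 2 * (k + 1) + 1 = 2 * k + 1 + 2 by ring, hf, ih.2]⟩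
    intro k
    induction k with
    | zero => simp
    | succ k ih =>
      rw [show 2 * (k + 1) = 2 * k + 1 + 1 by ring, Finset.sum_range_succ, Finset.sum_range_succ,
        ih, (he k).1, (he k).2]
      push_cast; ring
  have := sum_area_inter_regularSector_le hL hfin (N := 2 * n) (by omega)
  rw [hsum] at this
  have e0 : regularSector (2 * n) 0 = sector 1 (exp (π * I / n)) := by
    unfold regularSector
    congr 1
    · simp
    · congr 1; push_cast; field_simp; ring
  have e1 : regularSector (2 * n) 1 = sector (exp (π * I / n)) (exp (2 * π * I / n)) := by
    unfold regularSector
    congr 2 <;> push_cast <;> field_simp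
    ring
  rwa [e0, e1] at this

end Complex

section polarBody

open Complex

variable {K : Set ℂ}

lemma convex_polarBody : Convex ℝ (polarBody K) := by
  intro x hx y hy a b ha hb hab z hz
  rw [inner_add_left, real_inner_smul_left, real_inner_smul_left]
  nlinarith [hx z hz, hy z hz]

lemma isClosed_polarBody : IsClosed (polarBody K) := by
  have : polarBody K = ⋂ y ∈ K, {x | ⟪x, y⟫ ≤ 1} := by ext; simp [polarBody]
  rw [this]
  exact isClosed_biInter fun y _ => isClosed_le (by fun_prop) continuous_const

lemma zero_mem_polarBody : (0 : ℂ) ∈ polarBody K := by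
  intro y _; simp

lemma volume_polarBody_ne_top (h0 : (0 : ℂ) ∈ interior K) : volume (polarBody K) ≠ ⊤ := by
  obtain ⟨δ, hδ, hb⟩ := Metric.isOpen_iff.1 isOpen_interior 0 h0
  have hball : volume (Metric.closedBall (0 : ℂ) (2 / δ)) ≠ ⊤ := measure_closedBall_lt_top.ne
  refine measure_ne_top_of_subset ?_ hball
  intro x hx
  rw [mem_closedBall_zero_iff]
  by_cases hx0 : x = 0
  · subst hx0; simp; positivity
  have hn : 0 < ‖x‖ := norm_pos_iff.2 hx0
  have hm : ((δ / 2 / ‖x‖ : ℝ) • x) ∈ K := interior_subset (hb (by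
    rw [mem_ball_zero_iff, norm_smul, Real.norm_of_nonneg (by positivity)]
    field_simp; linarith))
  have := hx _ hm
  rw [real_inner_smul_right, real_inner_self_eq_norm_sq] at this
  rw [le_div_iff₀ hδ]
  field_simp at this
  linarith

/-- The nontrivial half of the bipolar theorem. -/
lemma mem_of_forall_inner_polarBody_le (hc : Convex ℝ K) (hK : IsClosed K) (h0 : (0 : ℂ) ∈ K)
    {x : ℂ} (hx : ∀ y ∈ polarBody K, ⟪y, x⟫ ≤ 1) : x ∈ K := by
  by_contra hxK
  obtain ⟨f, u, hf, hfx⟩ := geometric_hahn_banach_closed_point hc hK hxK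
  have hu : 0 < u := by simpa using hf 0 h0
  let v : ℂ := (InnerProductSpace.toDual ℝ ℂ).symm f
  have hv : ∀ z, ⟪v, z⟫ = f z := fun z => InnerProductSpace.toDual_symm_apply
  have := hx (u⁻¹ • v) (by
    intro z hz
    rw [real_inner_smul_left, hv, inv_mul_le_iff₀ hu]
    linarith [hf z hz])
  rw [real_inner_smul_left, hv, inv_mul_le_iff₀ hu] at this
  linarith

lemma polarBody_smul {c : ℂ} (hc : c ≠ 0) :
    polarBody (c • K) = ((starRingEnd ℂ) c)⁻¹ • polarBody K := by
  have hc' : ((starRingEnd ℂ) c)⁻¹ ≠ 0 := by simpa using hc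
  ext x
  rw [Set.mem_smul_set_iff_inv_smul_mem₀ hc', inv_inv]
  have : ∀ y : ℂ, ⟪x, c * y⟫ = ⟪(starRingEnd ℂ) c * x, y⟫ := by
    intro y; simp; ring
  simp only [polarBody, Set.mem_ofPred_eq, Set.mem_smul_set, smul_eq_mul]
  constructor
  · intro h y hy
    rw [← this]; exact h _ ⟨y, hy, rfl⟩
  · rintro h _ ⟨y, hy, rfl⟩
    rw [this]; exact h y hy

lemma norm_exp_two_pi_div (n : ℕ) : ‖exp (2 * π * I / n)‖ = 1 := by
  rw [show 2 * π * I / n = ((2 * π / n : ℝ) : ℂ) * I by push_cast; ring]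
  exact norm_exp_ofReal_mul_I _

lemma HasNFoldSymmetry.polarBody {n : ℕ} (h : HasNFoldSymmetry n K) :
    HasNFoldSymmetry n (polarBody K) := by
  unfold HasNFoldSymmetry at *
  conv_rhs => rw [← h, polarBody_smul (exp_ne_zero _)]
  congr 1
  have := norm_exp_two_pi_div n
  have h1 : exp (2 * π * I / n) * (starRingEnd ℂ) (exp (2 * π * I / n)) = 1 := by
    rw [mul_conj, normSq_eq_norm_sq, this]; simp
  exact eq_inv_of_mul_eq_one_left h1

lemma HasNFoldSymmetry.pow_mul_mem {n : ℕ} (h : HasNFoldSymmetry n K) (k : ℕ) {x : ℂ}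
    (hx : x ∈ K) : exp (2 * π * I / n) ^ k * x ∈ K := by
  induction k with
  | zero => simpa
  | succ k ih =>
    have := Set.smul_mem_smul_set (a := exp (2 * π * I / n)) ih
    rwa [show exp (2 * π * I / n) • K = K from h, smul_eq_mul, ← mul_assoc, ← pow_succ'] at this

lemma area_smul_mul_area_polarBody {c : ℂ} (hc : c ≠ 0) :
    area (c • K) * area (polarBody (c • K)) = area K * area (polarBody K) := by
  have : ‖c‖ ≠ 0 := by simpa using hc
  rw [polarBody_smul hc, area_smul, area_smul, norm_inv, RCLike.norm_conj]
  field_simp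

/-- A lower bound for the product of the areas of corresponding sectors of `K` and of its polar. -/
lemma inner_sub_sub_le (hc : Convex ℝ K) (h0 : (0 : ℂ) ∈ interior K) (hfin : volume K ≠ ⊤)
    {A B A' B' : ℂ} (hAB : 0 < cross A B) (hA : A ∈ K) (hB : B ∈ K)
    (hA1 : ∀ t : ℝ, (t : ℂ) * A ∈ K → t ≤ 1) (hB1 : ∀ t : ℝ, (t : ℂ) * B ∈ K → t ≤ 1)
    (hAB' : 0 < cross A' B') (hA' : A' ∈ polarBody K) (hB' : B' ∈ polarBody K)
    (hA1' : ∀ t : ℝ, (t : ℂ) * A' ∈ polarBody K → t ≤ 1)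
    (hB1' : ∀ t : ℝ, (t : ℂ) * B' ∈ polarBody K → t ≤ 1) :
    ⟪B - A, B' - A'⟫ ≤
      4 * (area (K ∩ sector A B) * area (polarBody K ∩ sector A' B')) := by
  have h1 := fun x hx => cross_sub_le hc (interior_subset h0) hfin hAB hA hB hA1 hB1 (x := x) hx
  have ha : 0 < 2 * area (K ∩ sector A B) := by
    refine lt_of_lt_of_le ?_ (h1 A hA)
    have : cross A (B - A) = cross A B := by simp [cross]; ring
    rwa [this]
  obtain ⟨a, hae⟩ : ∃ a, a = 2 * area (K ∩ sector A B) := ⟨_, rfl⟩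
  rw [← hae] at ha
  simp only [← hae] at h1
  have hy : a⁻¹ • (-I * (B - A)) ∈ polarBody K := by
    intro x hx
    rw [real_inner_smul_left, inv_mul_le_iff₀ ha, mul_one]
    have : ⟪-I * (B - A), x⟫ = cross x (B - A) := by
      simp only [real_inner_eq, cross, mul_re, mul_im, neg_re, neg_im, I_re, I_im, sub_re, sub_im]
      ring
    rw [this]
    exact h1 x hx
  have h2 := cross_sub_le convex_polarBody zero_mem_polarBody (volume_polarBody_ne_top h0) hAB' hA'
    hB' hA1' hB1' hy
  have e : cross (a⁻¹ • (-I * (B - A))) (B' - A') = a⁻¹ * ⟪B - A, B' - A'⟫ := by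
    simp [cross]; ring
  rw [e, inv_mul_le_iff₀ ha, hae] at h2
  linarith

end polarBody

lemma le_of_stability_bounds {ε c s r h : ℝ} (hε : 0 < ε) (hc : 1 / 2 ≤ c) (hc1 : c < 1)
    (hs : s ^ 2 + c ^ 2 = 1) (hr : c ≤ r) (hh : c ≤ h) (hh1 : h ≤ 1)
    (h1 : h ≤ (1 + ε) * r) (h2 : 1 + r / h - c * (r + 1 / h) ≤ (1 + ε) * s ^ 2) :
    h ≤ (1 + 18 * ε) * c := by
  have hh0 : 0 < h := by linarith
  have h3 : (r - c) * (1 / h - c) ≤ ε * s ^ 2 := by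
    have : 1 + r / h - c * (r + 1 / h) = (r - c) * (1 / h - c) + s ^ 2 := by
      field_simp; linear_combination (-h) * hs
    linarith
  have h4 : 1 ≤ 1 / h := by rw [le_div_iff₀ hh0]; linarith
  have h5 : (r - c) * (1 - c) ≤ (ε * (1 + c)) * (1 - c) := by
    have : s ^ 2 = (1 + c) * (1 - c) := by linear_combination hs
    rw [this] at h3
    nlinarith [mul_le_mul_of_nonneg_left h4 (sub_nonneg.2 hr)]
  have h6 := le_of_mul_le_mul_right h5 (by linarith)
  rcases le_total ε 1 with he | he <;> nlinarith

lemma le_of_products_le {n s h r a b V W ε : ℝ} (hn : 0 < n) (hs : 0 < s) (hr : 0 < r) (hh : 0 < h)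
    (hb : 0 ≤ b) (h1 : s * h ≤ a) (h2 : s ≤ r * b) (h3 : n * a ≤ V) (h4 : n * b ≤ W)
    (h5 : V * W ≤ (1 + ε) * (n ^ 2 * s ^ 2)) : h ≤ (1 + ε) * r := by
  have ha : 0 ≤ a := le_trans (by positivity) h1
  have hV : 0 ≤ V := le_trans (by positivity) h3
  have g1 : (s * h) * s ≤ a * (r * b) := by gcongr
  have g2 : (n * a) * (n * b) ≤ V * W := by gcongr
  have g3 := mul_le_mul_of_nonneg_left (g2.trans h5) hr.le
  have g4 := mul_le_mul_of_nonneg_left g1 (sq_nonneg n)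
  refine le_of_mul_le_mul_left (a := n ^ 2 * s ^ 2) ?_ (by positivity)
  linarith

lemma le_of_sum_products_le {n a₁ a₂ b₁ b₂ D U V W : ℝ} (hn : 0 < n) (hD : 0 ≤ D) (ha₁ : 0 ≤ a₁)
    (ha₂ : 0 ≤ a₂) (hb₁ : 0 ≤ b₁) (hb₂ : 0 ≤ b₂) (h1 : D ≤ 4 * (a₁ * b₁)) (h2 : D ≤ 4 * (a₂ * b₂))
    (h3 : n * (a₁ + a₂) ≤ V) (h4 : n * (b₁ + b₂) ≤ W) (h5 : V * W ≤ n ^ 2 * U) : D ≤ U := by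
  have hV : 0 ≤ V := le_trans (by positivity) h3
  have q : D / 2 ≤ a₁ * b₂ + a₂ * b₁ := by
    rw [← sq_le_sq₀ (by positivity) (by positivity)]
    have : D * D ≤ (4 * (a₁ * b₁)) * (4 * (a₂ * b₂)) := by gcongr
    nlinarith [sq_nonneg (a₁ * b₂ - a₂ * b₁)]
  have g1 : D ≤ (a₁ + a₂) * (b₁ + b₂) := by linarith
  have g2 : (n * (a₁ + a₂)) * (n * (b₁ + b₂)) ≤ V * W := by gcongr
  have g4 := mul_le_mul_of_nonneg_left g1 (sq_nonneg n)
  refine le_of_mul_le_mul_left (a := n ^ 2) ?_ (by positivity)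
  linarith

lemma inner_mul_mul_of_norm_eq_one {c : ℂ} (hc : ‖c‖ = 1) (u v : ℂ) :
    ⟪c * u, c * v⟫ = ⟪u, v⟫ := by
  have : Complex.normSq c = 1 := by rw [Complex.normSq_eq_norm_sq, hc, one_pow]
  rw [Complex.normSq_apply] at this
  simp only [Complex.real_inner_eq, Complex.mul_re, Complex.mul_im]
  linear_combination (u.re * v.re + u.im * v.im) * this

open Complex in
/-- A normalized body with small volume product lies in a slightly enlarged regular polygon. -/
lemma inner_le_of_volume_product_le {n : ℕ} (hn : 3 ≤ n) {K : Set ℂ} (hc : Convex ℝ K)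
    (hK : IsCompact K) (h0 : (0 : ℂ) ∈ interior K) (hsym : HasNFoldSymmetry n K)
    (h1K : (1 : ℂ) ∈ K) (hnorm : ∀ x ∈ K, ‖x‖ ≤ 1) {ε : ℝ} (hε : 0 < ε)
    (hvp : area K * area (polarBody K) ≤ (1 + ε) * ((n : ℝ) ^ 2 * Real.sin (π / n) ^ 2))
    {x : ℂ} (hx : x ∈ K) : ⟪x, exp (π * I / n)⟫ ≤ (1 + 18 * ε) * Real.cos (π / n) := by
  have hn0 : (0 : ℝ) < n := by positivity
  have hn3 : (3 : ℝ) ≤ n := by exact_mod_cast hn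
  have hang : π / n ≤ π / 3 := by gcongr
  have hang0 : 0 < π / n := by positivity
  have hc2 : 1 / 2 ≤ Real.cos (π / n) := by
    rw [← Real.cos_pi_div_three]
    exact Real.cos_le_cos_of_nonneg_of_le_pi hang0.le (by linarith [pi_pos]) hang
  have hs0 : 0 < Real.sin (π / n) := Real.sin_pos_of_pos_of_lt_pi hang0 (by linarith [pi_pos])
  have hsc : Real.sin (π / n) ^ 2 + Real.cos (π / n) ^ 2 = 1 := Real.sin_sq_add_cos_sq _
  obtain ⟨m, hm⟩ : ∃ m : ℂ, m = exp (π * I / n) := ⟨_, rfl⟩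
  have hmexp : m = exp ((π / n : ℝ) * I) := by rw [hm]; congr 1; push_cast; ring
  have hmre : m.re = Real.cos (π / n) := by rw [hmexp, exp_ofReal_mul_I_re]
  have hmim : m.im = Real.sin (π / n) := by rw [hmexp, exp_ofReal_mul_I_im]
  have hζm : exp (2 * π * I / n) = m * m := by rw [hm, ← Complex.exp_add]; congr 1; ring
  have hVK := card_mul_area_sector_le hK.measurableSet hK.measure_lt_top.ne hn hsym
  have hVP := card_mul_area_sector_le isClosed_polarBody.measurableSet
    (volume_polarBody_ne_top h0) hn hsym.polarBody
  have hWK := card_mul_area_half_sectors_le hK.measurableSet hK.measure_lt_top.ne hn hsym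
  have hWP := card_mul_area_half_sectors_le isClosed_polarBody.measurableSet
    (volume_polarBody_ne_top h0) hn hsym.polarBody
  have hζK : m * m ∈ K := by
    rw [← hζm]; simpa using hsym.pow_mul_mem 1 h1K
  have hmn : ‖m‖ = 1 := by rw [hmexp]; exact norm_exp_ofReal_mul_I _
  rw [← hm]
  rw [← hm, hζm] at hWK hWP
  rw [hζm] at hVK hVP
  generalize Real.cos (π / n) = c at *
  generalize Real.sin (π / n) = s at *
  have hpolar : ∀ u : ℂ, ‖u‖ = 1 → u ∈ polarBody K := by
    intro u hu y hy
    have := real_inner_le_norm u y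
    rw [hu] at this
    linarith [hnorm y hy]
  have h1P : (1 : ℂ) ∈ polarBody K := hpolar 1 (by simp)
  have hζP : m * m ∈ polarBody K := hpolar _ (by simp [hmn])
  have h1K1 : ∀ t : ℝ, (t : ℂ) * 1 ∈ K → t ≤ 1 := by
    intro t ht
    have := hnorm _ ht
    simp only [mul_one, norm_real, Real.norm_eq_abs] at this
    exact (le_abs_self t).trans this
  have hζK1 : ∀ t : ℝ, (t : ℂ) * (m * m) ∈ K → t ≤ 1 := by
    intro t ht
    have := hnorm _ ht
    simp only [norm_mul, hmn, mul_one, norm_real, Real.norm_eq_abs] at this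
    exact (le_abs_self t).trans this
  have h1P1 : ∀ t : ℝ, (t : ℂ) * 1 ∈ polarBody K → t ≤ 1 := by
    intro t ht
    simpa [real_inner_eq] using ht 1 h1K
  have hζζ : (c * c - s * s) ^ 2 + (2 * (c * s)) ^ 2 = 1 := by
    linear_combination (s ^ 2 + c ^ 2 + 1) * hsc
  have hζP1 : ∀ t : ℝ, (t : ℂ) * (m * m) ∈ polarBody K → t ≤ 1 := by
    intro t ht
    have := ht _ hζK
    simp [hmre, hmim] at this
    linear_combination this - t * hζζ
  obtain ⟨x₀, hx₀, hmax⟩ := hK.exists_isMaxOn ⟨1, h1K⟩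
    (f := fun y => ⟪y, m⟫) (by fun_prop)
  obtain ⟨h, hh⟩ : ∃ h : ℝ, h = ⟪x₀, m⟫ := ⟨_, rfl⟩
  have hmax' : ∀ y ∈ K, ⟪y, m⟫ ≤ h := fun y hy => hh ▸ hmax hy
  obtain ⟨r, hrK, hrmax⟩ : ∃ r : ℝ, (r : ℂ) * m ∈ K ∧ ∀ t : ℝ, (t : ℂ) * m ∈ K → t ≤ r := by
    have hcl : IsClosed {t : ℝ | (t : ℂ) * m ∈ K} := hK.isClosed.preimage (by fun_prop)
    have hne : {t : ℝ | (t : ℂ) * m ∈ K}.Nonempty :=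
      ⟨0, by simpa using interior_subset h0⟩
    have hbd : BddAbove {t : ℝ | (t : ℂ) * m ∈ K} := by
      refine ⟨1, fun t ht => ?_⟩
      have := hnorm _ ht
      simp only [norm_mul, hmn, mul_one, norm_real, Real.norm_eq_abs] at this
      exact (le_abs_self t).trans this
    exact ⟨_, hcl.csSup_mem hne hbd, fun t ht => le_csSup hbd ht⟩
  have hcr : c ≤ r := by
    apply hrmax
    have := hc h1K hζK (a := 1 / 2) (b := 1 / 2) (by norm_num) (by norm_num) (by norm_num)
    convert this using 1
    apply Complex.ext <;> simp [hmre, hmim]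
    · linear_combination hsc / 2
    · ring
  have hch : c ≤ h := by
    have := hmax' 1 h1K
    simpa [real_inner_eq, hmre] using this
  have hh1 : h ≤ 1 := by
    have := real_inner_le_norm x₀ m
    rw [hmn] at this
    linarith [hnorm x₀ hx₀]
  have hc1 : c < 1 := by nlinarith
  have hr0 : 0 < r := by linarith
  have hh0 : 0 < h := by linarith
  have hmP : ((1 / h : ℝ) : ℂ) * m ∈ polarBody K := by
    intro y hy
    rw [← real_smul, real_inner_smul_left, real_inner_comm, one_div, inv_mul_le_iff₀ hh0, mul_one]
    exact hmax' y hy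
  have hrK1 : ∀ t : ℝ, (t : ℂ) * (r * m) ∈ K → t ≤ 1 := by
    intro t ht
    have := hrmax (t * r) (by push_cast; rwa [mul_assoc])
    nlinarith
  have hmP1 : ∀ t : ℝ, (t : ℂ) * (((1 / h : ℝ) : ℂ) * m) ∈ polarBody K → t ≤ 1 := by
    intro t ht
    have := ht x₀ hx₀
    rw [← real_smul, ← real_smul, real_inner_smul_left, real_inner_smul_left, real_inner_comm,
      ← hh] at this
    field_simp at this
    exact this
  have hcr1 : ∀ u : ℝ, cross 1 (u * m) = u * s := by intro u; simp [cross, hmim]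
  have hcr2 : ∀ u : ℝ, cross (u * m) (m * m) = u * s := by
    intro u; simp [cross, hmre, hmim]; linear_combination (u * s) * hsc
  have hcr3 : cross 1 (m * m) = 2 * (s * c) := by simp [cross, hmre, hmim]; ring
  have hcr3' : 0 < cross 1 (m * m) := by rw [hcr3]; positivity
  have hh' : 0 < 1 / h := by positivity
  have k1 := inner_sub_sub_le hc h0 hK.measure_lt_top.ne (by rw [hcr1]; positivity) h1K hrK h1K1
    hrK1 (by rw [hcr1]; positivity) h1P hmP h1P1 hmP1
  have k2 := inner_sub_sub_le hc h0 hK.measure_lt_top.ne (by rw [hcr2]; positivity) hrK hζK hrK1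
    hζK1 (by rw [hcr2]; positivity) hmP hζP hmP1 hζP1
  rw [sector_smul_right hr0, sector_smul_right hh'] at k1
  rw [sector_smul_left hr0, sector_smul_left hh'] at k2
  have e1 : ⟪(r : ℂ) * m - 1, ((1 / h : ℝ) : ℂ) * m - 1⟫ = 1 + r / h - c * (r + 1 / h) := by
    simp [hmre, hmim]; field_simp; linear_combination r * hsc
  have e2 : ⟪m * m - (r : ℂ) * m, m * m - ((1 / h : ℝ) : ℂ) * m⟫ =
      1 + r / h - c * (r + 1 / h) := by
    simp [hmre, hmim]; field_simp
    linear_combination h * hζζ + (r - c - r * h * c) * hsc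
  rw [e1] at k1
  rw [e2] at k2
  have hnn : ∀ L : Set ℂ, 0 ≤ area L := fun L => ENNReal.toReal_nonneg
  have hfirst : h ≤ (1 + ε) * r := by
    have f1 := cross_sub_le hc (interior_subset h0) hK.measure_lt_top.ne hcr3' h1K hζK h1K1 hζK1 hx₀
    have f2 := fun y hy => cross_sub_le convex_polarBody zero_mem_polarBody
      (volume_polarBody_ne_top h0) hcr3' h1P hζP h1P1 hζP1 (x := y) hy
    have hcx : ∀ y : ℂ, cross y (m * m - 1) = 2 * (s * ⟪y, m⟫) := by
      intro y; simp [cross, hmre, hmim]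
      linear_combination y.im * (-hsc)
    simp only [hcx] at f1 f2
    rw [← hh] at f1
    have hb0 : 0 < area (polarBody K ∩ sector 1 (m * m)) := by
      have := f2 1 h1P
      have e : ⟪(1 : ℂ), m⟫ = c := by simp [hmre]
      rw [e] at this
      have : 0 < s * c := by positivity
      linarith
    have f3 : s ≤ r * area (polarBody K ∩ sector 1 (m * m)) := by
      rw [← div_le_iff₀ hb0]
      apply hrmax
      apply mem_of_forall_inner_polarBody_le hc hK.isClosed (interior_subset h0)
      intro y hy
      rw [← real_smul, real_inner_smul_right, div_mul_eq_mul_div, div_le_one hb0]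
      linarith [f2 y hy]
    exact le_of_products_le hn0 hs0 hr0 hh0 hb0.le (by linarith) f3 hVK hVP hvp
  have hsecond : 1 + r / h - c * (r + 1 / h) ≤ (1 + ε) * s ^ 2 := by
    have h4 : 1 ≤ 1 / h := by rw [le_div_iff₀ hh0]; linarith
    have hD : 1 + r / h - c * (r + 1 / h) = (r - c) * (1 / h - c) + s ^ 2 := by
      field_simp; linear_combination (-h) * hsc
    have hD0 := mul_nonneg (sub_nonneg.2 hcr) (by linarith : 0 ≤ 1 / h - c)
    exact le_of_sum_products_le hn0 (by rw [hD]; positivity) (hnn _) (hnn _) (hnn _) (hnn _)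
      k1 k2 hWK hWP (hvp.trans_eq (by ring))
  exact (hmax' x hx).trans
    (le_of_stability_bounds hε hc2 hc1 hsc hcr hch hh1 hfirst hsecond)

open Complex in
lemma exp_two_pi_div_pow {n : ℕ} (hn : 0 < n) : exp (2 * π * I / n) ^ n = 1 := by
  have hn0 : (n : ℂ) ≠ 0 := by exact_mod_cast hn.ne'
  rw [← Complex.exp_nat_mul, mul_div_cancel₀ _ hn0, exp_two_pi_mul_I]

open Complex in
lemma exp_pow_mem_ngonVertices {n : ℕ} (hn : 0 < n) (k : ℕ) :
    exp (2 * π * I / n) ^ k ∈ ngonVertices n 0 1 := by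
  refine ⟨⟨k % n, Nat.mod_lt _ hn⟩, ?_⟩
  rw [pow_eq_pow_mod k (exp_two_pi_div_pow hn), ← Complex.exp_nat_mul]
  simp only [zero_add, one_mul]
  congr 1; ring

open Complex in
/-- A point satisfying all the inequalities defining a regular polygon lies in it. -/
lemma mem_convexHull_ngonVertices {n : ℕ} (hn : 3 ≤ n) {x : ℂ}
    (hx : ∀ k : ℕ, ⟪x, exp (2 * π * I / n) ^ k * exp (π * I / n)⟫ ≤ Real.cos (π / n)) :
    x ∈ convexHull ℝ (ngonVertices n 0 1) := by
  have hn0 : (0 : ℝ) < n := by positivity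
  have hn3 : (3 : ℝ) ≤ n := by exact_mod_cast hn
  obtain ⟨α, hα⟩ : ∃ α : ℝ, α = π / n := ⟨_, rfl⟩
  have hα0 : 0 < α := by rw [hα]; positivity
  have hαn : α * n = π := by rw [hα]; field_simp
  have hα3 : 3 * α ≤ π := by nlinarith
  have hcos : 0 < Real.cos α := Real.cos_pos_of_mem_Ioo ⟨by linarith, by linarith⟩
  have hm : exp (π * I / n) = exp (α * I) := by rw [hα]; congr 1; push_cast; ring
  have hζ : exp (2 * π * I / n) = exp (α * I) ^ 2 := by
    rw [← Complex.exp_nat_mul, hα]; congr 1; push_cast; ring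
  rw [← hα, hm] at hx
  have hvert := fun k => subset_convexHull ℝ _ (exp_pow_mem_ngonVertices (n := n) (by omega) k)
  have hcvx := convex_convexHull ℝ (ngonVertices n 0 1)
  have h0 : (0 : ℂ) ∈ convexHull ℝ (ngonVertices n 0 1) := by
    have := hcvx.sum_mem (t := Finset.range n) (w := fun _ => (n : ℝ)⁻¹)
      (z := fun k => exp (2 * π * I / n) ^ k) (fun _ _ => by positivity)
      (by simp; field_simp) (fun k _ => hvert k)
    rwa [← Finset.smul_sum,
      (isPrimitiveRoot_exp n (by omega)).geom_sum_eq_zero (by omega), smul_zero] at this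
  obtain ⟨k, ψ, hψ0, hψ1, hψ⟩ : ∃ (k : ℕ) (ψ : ℝ), 0 ≤ ψ ∧ ψ ≤ 2 * α ∧
      x = exp (2 * π * I / n) ^ k * ((‖x‖ : ℝ) * exp (ψ * I)) := by
    obtain ⟨θ, hθ0, hθ⟩ : ∃ θ : ℝ, 0 ≤ θ ∧ x = (‖x‖ : ℝ) * exp (θ * I) := by
      refine ⟨arg x + 2 * π, by linarith [neg_pi_lt_arg x, pi_pos], ?_⟩
      conv_lhs => rw [← norm_mul_exp_arg_mul_I x]
      push_cast
      rw [add_mul, Complex.exp_add, exp_two_pi_mul_I, mul_one]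
    have hk := Nat.floor_le (a := θ / (2 * α)) (by positivity)
    have hk' := Nat.lt_floor_add_one (θ / (2 * α))
    rw [le_div_iff₀ (by positivity)] at hk
    rw [div_lt_iff₀ (by positivity)] at hk'
    refine ⟨⌊θ / (2 * α)⌋₊, θ - ⌊θ / (2 * α)⌋₊ * (2 * α), by linarith, by linarith, ?_⟩
    conv_lhs => rw [hθ]
    rw [hζ, ← pow_mul, ← Complex.exp_nat_mul, mul_left_comm, ← Complex.exp_add]
    congr 2; push_cast; ring
  obtain ⟨p, q, hp, hq, hpq⟩ : ∃ p q : ℝ, 0 ≤ p ∧ 0 ≤ q ∧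
      (‖x‖ : ℝ) * exp (ψ * I) = p + q * exp (α * I) ^ 2 := by
    have h2 : 0 < Real.sin (2 * α) := Real.sin_pos_of_pos_of_lt_pi (by linarith) (by linarith)
    have h3 := Real.sin_nonneg_of_nonneg_of_le_pi hψ0 (by linarith)
    have h4 := Real.sin_nonneg_of_nonneg_of_le_pi (x := 2 * α - ψ) (by linarith) (by linarith)
    refine ⟨‖x‖ * (Real.sin (2 * α - ψ) / Real.sin (2 * α)),
      ‖x‖ * (Real.sin ψ / Real.sin (2 * α)), by positivity, by positivity, ?_⟩
    have e : exp (α * I) ^ 2 = exp ((2 * α : ℝ) * I) := by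
      rw [← Complex.exp_nat_mul]; congr 1; push_cast; ring
    rw [e]
    generalize ‖x‖ = ρ
    generalize 2 * α = β at *
    have hs := h2.ne'
    apply Complex.ext
    · simp [exp_ofReal_mul_I_re, exp_ofReal_mul_I_im, -ofReal_sin, -ofReal_cos]
      field_simp
      rw [Real.sin_sub]; ring
    · simp [exp_ofReal_mul_I_re, exp_ofReal_mul_I_im, -ofReal_sin, -ofReal_cos]
      field_simp
  have hsum : p + q ≤ 1 := by
    have := hx k
    rw [hψ, inner_mul_mul_of_norm_eq_one (by rw [norm_pow, norm_exp_two_pi_div, one_pow]), hpq,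
      pow_two] at this
    simp only [real_inner_eq, add_re, add_im, mul_re, mul_im, ofReal_re, ofReal_im,
      exp_ofReal_mul_I_re, exp_ofReal_mul_I_im] at this
    have hsc := Real.sin_sq_add_cos_sq α
    have h5 : (p + q) * Real.cos α ≤ 1 * Real.cos α := by
      linear_combination this - q * Real.cos α * hsc
    exact le_of_mul_le_mul_right h5 hcos
  rw [hψ, hpq, ← hζ]
  have := hcvx.sum_mem (t := Finset.univ) (w := ![1 - p - q, p, q])
    (z := ![0, exp (2 * π * I / n) ^ k, exp (2 * π * I / n) ^ (k + 1)])
    (by intro i _; fin_cases i <;> simp <;> linarith)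
    (by simp [Fin.sum_univ_three]; ring)
    (by intro i _; fin_cases i <;> simp only [Fin.zero_eta, Fin.mk_one, Fin.reduceFinMk,
          Matrix.cons_val] <;> first | exact h0 | exact hvert _)
  convert this using 1
  simp [Fin.sum_univ_three]; ring

lemma ngonVertices_eq_image (n : ℕ) (z w : ℂ) :
    convexHull ℝ (ngonVertices n z w) =
      (fun v => z + w * v) '' convexHull ℝ (ngonVertices n 0 1) := by
  let f : ℂ →ᵃ[ℝ] ℂ := (LinearMap.mulLeft ℝ w).toAffineMap + AffineMap.const ℝ ℂ z
  have hf : (f : ℂ → ℂ) = fun v => z + w * v := by ext v; simp [f, add_comm]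
  rw [← hf, AffineMap.image_convexHull, hf]
  congr 1
  unfold ngonVertices
  rw [← Set.range_comp]
  congr 1
  ext k; simp

lemma distBMsim_le {K L : Set ℂ} {l1 l2 : ℝ} (hl1 : 0 < l1) (hl2 : 0 < l2) {A : ℂ → ℂ}
    (hA : IsSimilarity A) {x : ℂ} (h1 : l1 • (A '' K) ⊆ L) (h2 : L ⊆ x +ᵥ l2 • (A '' K)) :
    distBMsim K L ≤ l2 / l1 := by
  refine csInf_le ⟨0, ?_⟩ ⟨l1, l2, A, x, hl1, hl2, hA, rfl, h1, h2⟩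
  rintro _ ⟨a, b, -, -, ha, hb, -, rfl, -⟩
  positivity

/-- Stability for bodies with `n`-fold rotational symmetry: if
`|K|·|K*| ≤ (1+ε)·n² sin²(π/n)`, then the similarity Banach–Mazur distance of
`K` from any regular `n`-gon `R_n` is at most `1 + 18ε`. -/
theorem nfold_stability (n : ℕ) (hn : 3 ≤ n) (K Rn : Set ℂ)
    (hK : IsConvexBody K) (ho : (0 : ℂ) ∈ interior K)
    (hsym : HasNFoldSymmetry n K)
    (z w : ℂ) (hRn : IsRegularNgon n z w Rn) (ε : ℝ) (hε : 0 < ε)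
    (hvp : area K * area (polarBody K) ≤ (1 + ε) * ((n : ℝ) ^ 2 * Real.sin (π / n) ^ 2)) :
    distBMsim K Rn ≤ 1 + 18 * ε := by
  obtain ⟨hc, hcomp, -⟩ := hK
  obtain ⟨hw, rfl⟩ := hRn
  obtain ⟨p, hp, hmax⟩ := hcomp.exists_isMaxOn ⟨0, interior_subset ho⟩
    (f := fun y : ℂ => ‖y‖) (by fun_prop)
  have hp0 : p ≠ 0 := by
    rintro rfl
    obtain ⟨δ, hδ, hb⟩ := Metric.isOpen_iff.1 isOpen_interior 0 ho
    have hm : ((δ / 2 : ℝ) : ℂ) ∈ K := interior_subset (hb (by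
      rw [mem_ball_zero_iff, Complex.norm_real, Real.norm_of_nonneg (by positivity)]
      linarith))
    have := hmax hm
    simp only [Set.mem_ofPred_eq, Complex.norm_real, norm_zero, Real.norm_eq_abs] at this
    rw [abs_of_pos (by positivity)] at this
    linarith
  have hpi : p⁻¹ ≠ 0 := inv_ne_zero hp0
  obtain ⟨M, hM⟩ : ∃ M : Set ℂ, M = p⁻¹ • K := ⟨_, rfl⟩
  have hMK : ∀ y, y ∈ M ↔ p * y ∈ K := by
    intro y; rw [hM, Set.mem_smul_set_iff_inv_smul_mem₀ hpi, inv_inv, smul_eq_mul]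
  have hMc : Convex ℝ M := by
    have : M = LinearMap.mulLeft ℝ p ⁻¹' K := by ext y; simp [hMK]
    exact this ▸ hc.linear_preimage _
  have hMsym : HasNFoldSymmetry n M := by
    unfold HasNFoldSymmetry at *
    rw [hM, smul_comm, hsym]
  have h1M : (1 : ℂ) ∈ M := by rw [hMK]; simpa
  have hMnorm : ∀ y ∈ M, ‖y‖ ≤ 1 := by
    intro y hy
    have := hmax ((hMK y).1 hy)
    simp only [Set.mem_ofPred_eq, norm_mul] at this
    have hp' : 0 < ‖p‖ := norm_pos_iff.2 hp0
    nlinarith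
  have hM0 : (0 : ℂ) ∈ interior M := by
    rw [hM, interior_smul₀ hpi]
    exact ⟨0, ho, by simp⟩
  have hMvp := hvp
  rw [← area_smul_mul_area_polarBody hpi, ← hM] at hMvp
  obtain ⟨l, hl⟩ : ∃ l : ℝ, l = 1 + 18 * ε := ⟨_, rfl⟩
  have hl0 : 0 < l := by rw [hl]; positivity
  have hl0' : (l : ℂ) ≠ 0 := by exact_mod_cast hl0.ne'
  have hin : ∀ y ∈ M, (l : ℂ)⁻¹ * y ∈ convexHull ℝ (ngonVertices n 0 1) := by
    intro y hy
    refine mem_convexHull_ngonVertices hn fun k => ?_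
    have h1 : Complex.exp (2 * π * Complex.I / n) ^ k *
        Complex.exp (2 * π * Complex.I / n) ^ ((n - 1) * k) = 1 := by
      rw [← pow_add, ← one_add_mul, Nat.add_sub_cancel' (by omega), pow_mul,
        exp_two_pi_div_pow (by omega), one_pow]
    have h2 := inner_le_of_volume_product_le hn hMc (hM ▸ hcomp.smul _) hM0 hMsym h1M hMnorm hε hMvp
      (hMsym.pow_mul_mem ((n - 1) * k) hy)
    rw [← inner_mul_mul_of_norm_eq_one (c := Complex.exp (2 * π * Complex.I / n) ^ k)
      (by rw [norm_pow, norm_exp_two_pi_div, one_pow]), ← mul_assoc, h1, one_mul, ← hl] at h2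
    rwa [← Complex.ofReal_inv, ← Complex.real_smul, real_inner_smul_left, inv_mul_le_iff₀ hl0]
  have hout : convexHull ℝ (ngonVertices n 0 1) ⊆ M := by
    refine convexHull_min ?_ hMc
    rintro _ ⟨k, rfl⟩
    have := hMsym.pow_mul_mem k h1M
    rw [← Complex.exp_nat_mul] at this
    convert this using 1
    simp only [zero_add, one_mul, mul_one]
    congr 1; ring
  rw [ngonVertices_eq_image]
  have := distBMsim_le (K := K) (L := (fun v => z + w * v) '' convexHull ℝ (ngonVertices n 0 1))
    one_pos hl0 (A := fun y => (w * p⁻¹ * (l : ℂ)⁻¹) * y + z) (x := z - l * z)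
    ⟨w * p⁻¹ * (l : ℂ)⁻¹, z, by simp [hw, hp0, hl0.ne'], Or.inl rfl⟩ ?_ ?_
  · rwa [div_one, hl] at this
  · rw [one_smul]
    rintro _ ⟨y, hy, rfl⟩
    refine ⟨_, hin (p⁻¹ * y) ((hMK _).2 (by rwa [mul_inv_cancel_left₀ hp0])), ?_⟩
    ring
  · rintro _ ⟨y, hy, rfl⟩
    refine ⟨_, ⟨_, ⟨_, (hMK y).1 (hout hy), rfl⟩, rfl⟩, ?_⟩
    simp only [vadd_eq_add, Complex.real_smul]
    field_simp
    ring
end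

section
/- Let K be a convex body in ℝ² with |K|·|((K−K)/2)*| ≤ (1+ε)·6 for some ε > 0, and let T be a triangle. Then δ_BM(K,T) ≤ 1 + 87ε. Here K−K = {y−z : y,z ∈ K} is the difference body. -/
open MeasureTheory Pointwise Real
open scoped RealInnerProductSpace

/-- `K` is a (nondegenerate) triangle. -/
def IsTriangle (K : Set ℂ) : Prop :=
  ∃ a b c : ℂ, AffineIndependent ℝ ![a, b, c] ∧ K = convexHull ℝ {a, b, c}

/-- Banach–Mazur distance of two planar convex bodies:
`inf {λ₂/λ₁ : ∃ invertible affine A and x with λ₁·A(K) ⊆ L ⊆ λ₂·A(K) + x}`. -/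
noncomputable def distBM (K L : Set ℂ) : ℝ :=
  sInf {r : ℝ | ∃ (l1 l2 : ℝ) (A : ℂ ≃ᵃ[ℝ] ℂ) (x : ℂ), 0 < l1 ∧ 0 < l2 ∧ r = l2 / l1 ∧
    l1 • (A '' K) ⊆ L ∧ L ⊆ x +ᵥ l2 • (A '' K)}

/-- The determinant of two planar vectors. -/
def cross (u v : ℂ) : ℝ := u.re * v.im - u.im * v.re

/-- The open triangle with apex `a` and edge vectors `u`, `v`. -/
def openTriangle (a u v : ℂ) : Set ℂ :=
  {z | ∃ s t : ℝ, 0 < s ∧ 0 < t ∧ s + t < 1 ∧ z = a + (s • u + t • v)}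

/-- The linear map sending `1` to `u` and `I` to `v`. -/
noncomputable def linOfImages (u v : ℂ) : ℂ →ₗ[ℝ] ℂ := Complex.basisOneI.constr ℝ ![u, v]

lemma linOfImages_apply (u v z : ℂ) : linOfImages u v z = z.re • u + z.im • v := by
  simp [linOfImages, Module.Basis.constr_apply_fintype]

lemma det_linOfImages (u v : ℂ) : LinearMap.det (linOfImages u v) = cross u v := by
  rw [← LinearMap.det_toMatrix Complex.basisOneI, Matrix.det_fin_two]
  simp [LinearMap.toMatrix_apply, linOfImages_apply, cross]
  ring

lemma volume_stdTriangle :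
    volume {z : ℂ | 0 < z.re ∧ 0 < z.im ∧ z.re + z.im < 1} = ENNReal.ofReal (1 / 2) := by
  have h : {z : ℂ | 0 < z.re ∧ 0 < z.im ∧ z.re + z.im < 1} =
      Complex.measurableEquivRealProd ⁻¹'
        (regionBetween (fun _ => 0) (fun x : ℝ => 1 - x) (Set.Ioo 0 1)) := by
    ext z
    simp only [regionBetween, Set.mem_ofPred_eq, Set.mem_preimage, Set.mem_Ioo,
      Complex.measurableEquivRealProd_apply]
    constructor
    · rintro ⟨h1, h2, h3⟩
      exact ⟨⟨h1, by linarith⟩, h2, by linarith⟩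
    · rintro ⟨⟨h1, h2⟩, h3, h4⟩
      exact ⟨h1, h3, by linarith⟩
  have hint : IntegrableOn (fun x : ℝ => 1 - x) (Set.Ioo 0 1) :=
    ((continuous_const.sub continuous_id).integrableOn_Icc (a := 0) (b := 1)).mono_set
      Set.Ioo_subset_Icc_self
  rw [h, Complex.volume_preserving_equiv_real_prod.measure_preimage_equiv, Measure.volume_eq_prod,
    volume_regionBetween_eq_integral (integrableOn_const (by simp)) hint measurableSet_Ioo
      (fun x hx => by linarith [hx.2])]
  congr 1
  simp only [Pi.sub_apply, sub_zero]
  rw [← integral_Ioc_eq_integral_Ioo, ← intervalIntegral.integral_of_le zero_le_one,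
    intervalIntegral.integral_sub (by simp) (by simp)]
  norm_num

lemma openTriangle_eq_image (a u v : ℂ) :
    openTriangle a u v =
      (a + ·) '' (linOfImages u v '' {z : ℂ | 0 < z.re ∧ 0 < z.im ∧ z.re + z.im < 1}) := by
  ext z
  simp only [openTriangle, Set.mem_image, Set.mem_ofPred_eq, linOfImages_apply]
  constructor
  · rintro ⟨s, t, hs, ht, hst, rfl⟩
    exact ⟨_, ⟨⟨s, t⟩, ⟨hs, ht, hst⟩, rfl⟩, rfl⟩
  · rintro ⟨_, ⟨w, ⟨h1, h2, h3⟩, rfl⟩, rfl⟩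
    exact ⟨w.re, w.im, h1, h2, h3, rfl⟩

lemma volume_openTriangle (a u v : ℂ) :
    volume (openTriangle a u v) = ENNReal.ofReal (|cross u v| / 2) := by
  rw [openTriangle_eq_image, Set.image_add_left, measure_preimage_add,
    Measure.addHaar_image_linearMap, det_linOfImages, volume_stdTriangle,
    ← ENNReal.ofReal_mul (abs_nonneg _)]
  congr 1
  ring

lemma area_openTriangle (a u v : ℂ) : area (openTriangle a u v) = |cross u v| / 2 := by
  rw [area, volume_openTriangle, ENNReal.toReal_ofReal (by positivity)]

lemma isOpen_openTriangle {a u v : ℂ} (h : cross u v ≠ 0) : IsOpen (openTriangle a u v) := by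
  have hL : IsUnit (LinearMap.det (linOfImages u v)) := by
    rw [det_linOfImages]; exact h.isUnit
  let L := (LinearEquiv.ofIsUnitDet (f := linOfImages u v)
    (v := Complex.basisOneI) (v' := Complex.basisOneI)
    (by rwa [LinearMap.det_toMatrix])).toContinuousLinearEquiv
  rw [openTriangle_eq_image]
  apply (Homeomorph.addLeft a).isOpenMap
  apply L.toHomeomorph.isOpenMap
  exact (isOpen_lt continuous_const Complex.continuous_re).inter
    ((isOpen_lt continuous_const Complex.continuous_im).inter
      (isOpen_lt (Complex.continuous_re.add Complex.continuous_im) continuous_const))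

lemma Convex.openTriangle_subset {K : Set ℂ} (hK : Convex ℝ K) {a b c : ℂ} (ha : a ∈ K)
    (hb : b ∈ K) (hc : c ∈ K) : openTriangle a (b - a) (c - a) ⊆ K := by
  rintro _ ⟨s, t, hs, ht, hst, rfl⟩
  have := hK.sum_mem (t := Finset.univ) (w := ![1 - s - t, s, t]) (z := ![a, b, c])
    (by intro i _; fin_cases i <;> simp <;> linarith)
    (by simp [Fin.sum_univ_three]; ring) (by intro i _; fin_cases i <;> simpa)
  convert this using 1
  simp [Fin.sum_univ_three]
  ring

lemma nullMeasurableSet_openTriangle (a u v : ℂ) :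
    NullMeasurableSet (openTriangle a u v) := by
  by_cases h : cross u v = 0
  · exact NullMeasurableSet.of_null (by simp [volume_openTriangle, h])
  · exact (isOpen_openTriangle h).measurableSet.nullMeasurableSet

/-- The areas of finitely many disjoint open triangles in a set of finite area add up to
at most its area. -/
lemma sum_area_openTriangle_le {ι : Type*} [Fintype ι] {S : Set ℂ} (hS : volume S ≠ ⊤)
    (a u v : ι → ℂ) (hsub : ∀ i, openTriangle (a i) (u i) (v i) ⊆ S)
    (hdisj : Pairwise fun i j =>
      Disjoint (openTriangle (a i) (u i) (v i)) (openTriangle (a j) (u j) (v j))) :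
    ∑ i, |cross (u i) (v i)| / 2 ≤ area S := by
  have h : volume (⋃ i, openTriangle (a i) (u i) (v i)) =
      ∑ i, volume (openTriangle (a i) (u i) (v i)) := by
    rw [measure_iUnion₀ (fun i j hij => (hdisj hij).aedisjoint)
      (fun i => nullMeasurableSet_openTriangle _ _ _), tsum_fintype]
  calc ∑ i, |cross (u i) (v i)| / 2
      = (volume (⋃ i, openTriangle (a i) (u i) (v i))).toReal := by
        rw [h, ENNReal.toReal_sum (fun i _ => by simp [volume_openTriangle])]
        exact Finset.sum_congr rfl fun i _ => (area_openTriangle _ _ _).symm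
    _ ≤ area S := ENNReal.toReal_mono hS (measure_mono (Set.iUnion_subset hsub))

/-- Twice the signed area of the triangle `xyz`. -/
def signedArea (x y z : ℂ) : ℝ := cross (y - x) (z - x)

lemma continuous_signedArea :
    Continuous fun p : ℂ × ℂ × ℂ => signedArea p.1 p.2.1 p.2.2 := by
  unfold signedArea cross
  have hr := Complex.continuous_re
  have hi := Complex.continuous_im
  fun_prop

lemma exists_isMaxOn_signedArea {K : Set ℂ} (hK : IsConvexBody K) :
    ∃ x ∈ K, ∃ y ∈ K, ∃ z ∈ K, 0 < signedArea x y z ∧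
      ∀ x' ∈ K, ∀ y' ∈ K, ∀ z' ∈ K, signedArea x' y' z' ≤ signedArea x y z := by
  obtain ⟨-, hc, c, hcK⟩ := hK
  obtain ⟨r, hr, hball⟩ := Metric.isOpen_iff.1 isOpen_interior c hcK
  have hball := hball.trans interior_subset
  have mem : ∀ w : ℂ, ‖w‖ < r → c + w ∈ K := fun w hw => hball (by simpa [dist_eq_norm] using hw)
  have h0 : c ∈ K := by simpa using mem 0 (by simpa)
  have hr2 : |r| / 2 < r := by rw [abs_of_pos hr]; linarith
  have h1 : c + (r / 2 : ℝ) ∈ K := mem _ (by simpa [-Complex.ofReal_div] using hr2)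
  have h2 : c + (r / 2 : ℝ) * Complex.I ∈ K := mem _ (by simpa using hr2)
  obtain ⟨⟨x, y, z⟩, ⟨hx, hy, hz⟩, hmax⟩ := (hc.prod (hc.prod hc)).exists_isMaxOn
    ⟨(c, c, c), h0, h0, h0⟩ continuous_signedArea.continuousOn
  have hmax' : ∀ x' ∈ K, ∀ y' ∈ K, ∀ z' ∈ K, signedArea x' y' z' ≤ signedArea x y z :=
    fun x' hx' y' hy' z' hz' => hmax (a := (x', y', z')) ⟨hx', hy', hz'⟩
  refine ⟨x, hx, y, hy, z, hz, lt_of_lt_of_le ?_ (hmax' _ h0 _ h1 _ h2), hmax'⟩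
  simp [signedArea, cross]
  positivity

lemma volume_polarBody_ne_top_s11 {K : Set ℂ} (hK : IsConvexBody K) :
    volume (polarBody ((2⁻¹ : ℝ) • (K - K))) ≠ ⊤ := by
  obtain ⟨-, -, c, hcK⟩ := hK
  obtain ⟨r, hr, hball⟩ := Metric.isOpen_iff.1 isOpen_interior c hcK
  have hball := hball.trans interior_subset
  refine ((measure_mono ?_).trans_lt (isCompact_closedBall (0 : ℂ) (2 / r)).measure_lt_top).ne
  intro x hx
  rw [mem_closedBall_zero_iff]
  rcases eq_or_ne x 0 with rfl | hx0
  · simp; positivity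
  have hn : 0 < ‖x‖ := norm_pos_iff.2 hx0
  set w : ℂ := (r / (2 * ‖x‖)) • x with hw
  have hwn : ‖w‖ < r := by
    rw [hw, norm_smul, Real.norm_of_nonneg (by positivity)]
    field_simp
    linarith
  have h := hx w ⟨(c + w) - (c - w), Set.sub_mem_sub
    (hball (by simpa [dist_eq_norm] using hwn)) (hball (by simpa [dist_eq_norm] using hwn)), by
      simp only [add_sub_sub_cancel, ← two_smul ℝ w, smul_smul]; norm_num⟩
  rw [hw, real_inner_smul_right, real_inner_self_eq_norm_sq] at h
  field_simp at h ⊢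
  linarith

/-- The vector representing the functional `y ↦ cross u y / D`. -/
noncomputable def crossDual (D : ℝ) (u : ℂ) : ℂ := ⟨-u.im / D, u.re / D⟩

lemma inner_crossDual (D : ℝ) (u y : ℂ) : ⟪crossDual D u, y⟫ = cross u y / D := by
  simp [crossDual, cross, Complex.inner]
  ring

lemma cross_crossDual (d e : ℝ) (u v : ℂ) :
    cross (crossDual d u) (crossDual e v) = cross u v / (d * e) := by
  simp only [crossDual, cross]
  ring

lemma cross_neg_left (u v : ℂ) : cross (-u) v = -cross u v := by
  simp [cross]; ring

lemma cross_neg_right (u v : ℂ) : cross u (-v) = -cross u v := by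
  simp [cross]; ring

lemma cross_swap (u v : ℂ) : cross v u = -cross u v := by
  simp [cross]; ring

/-- A convex body containing a triangle `xyz` has at least the area of the triangle together with
the caps over its sides spanned by three further points. -/
lemma le_area_of_caps {K : Set ℂ} (hK : IsConvexBody K) {x y z k₁ k₂ k₃ : ℂ}
    (hx : x ∈ K) (hy : y ∈ K) (hz : z ∈ K) (hk₁ : k₁ ∈ K) (hk₂ : k₂ ∈ K) (hk₃ : k₃ ∈ K)
    (hD : 0 < signedArea x y z)
    (hmax : ∀ x' ∈ K, ∀ y' ∈ K, ∀ z' ∈ K, signedArea x' y' z' ≤ signedArea x y z)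
    (h₁ : signedArea k₁ y z ≤ 0) (h₂ : signedArea x k₂ z ≤ 0) (h₃ : signedArea x y k₃ ≤ 0) :
    (signedArea x y z - signedArea k₁ y z - signedArea x k₂ z - signedArea x y k₃) / 2
      ≤ area K := by
  set D := signedArea x y z with hDdef
  let a : Fin 4 → ℂ := ![x, y, z, x]
  let b : Fin 4 → ℂ := ![y, z, x, y]
  let c : Fin 4 → ℂ := ![z, k₁, k₂, k₃]
  let P : Fin 4 → ℂ → Prop := ![
    fun p => 0 < signedArea p y z ∧ 0 < signedArea x p z ∧ 0 < signedArea x y p,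
    fun p => signedArea p y z ≤ 0 ∧ signedArea x p z < D ∧ signedArea x y p < D,
    fun p => signedArea x p z ≤ 0 ∧ signedArea x y p < D ∧ signedArea p y z < D,
    fun p => signedArea x y p ≤ 0 ∧ signedArea p y z < D ∧ signedArea x p z < D]
  have hsum : ∀ p, signedArea p y z + signedArea x p z + signedArea x y p = D := by
    intro p; simp only [hDdef, signedArea, cross, Complex.sub_re, Complex.sub_im]; ring
  -- the three area coordinates are affine
  have e₁ : ∀ (s t : ℝ) (a b c : ℂ), signedArea (a + (s • (b - a) + t • (c - a))) y z =
      (1 - s - t) * signedArea a y z + s * signedArea b y z + t * signedArea c y z := by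
    intro s t a b c; simp [signedArea, cross]; ring
  have e₂ : ∀ (s t : ℝ) (a b c : ℂ), signedArea x (a + (s • (b - a) + t • (c - a))) z =
      (1 - s - t) * signedArea x a z + s * signedArea x b z + t * signedArea x c z := by
    intro s t a b c; simp [signedArea, cross]; ring
  have e₃ : ∀ (s t : ℝ) (a b c : ℂ), signedArea x y (a + (s • (b - a) + t • (c - a))) =
      (1 - s - t) * signedArea x y a + s * signedArea x y b + t * signedArea x y c := by
    intro s t a b c; simp [signedArea, cross]; ring
  have z₁ : ∀ p q, signedArea p p q = 0 := by intro p q; simp [signedArea, cross]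
  have z₂ : ∀ p q, signedArea p q q = 0 := by intro p q; simp [signedArea, cross]; ring
  have z₃ : ∀ p q, signedArea p q p = 0 := by intro p q; simp [signedArea, cross]
  have hP : ∀ i, ∀ p ∈ openTriangle (a i) (b i - a i) (c i - a i), P i p := by
    rintro i _ ⟨s, t, hs, ht, hst, rfl⟩
    have a₁ := mul_le_mul_of_nonneg_left (hmax _ hk₁ _ hy _ hz) ht.le
    have a₂ := mul_le_mul_of_nonneg_left (hmax _ hk₂ _ hy _ hz) ht.le
    have a₃ := mul_le_mul_of_nonneg_left (hmax _ hk₃ _ hy _ hz) ht.le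
    have b₁ := mul_le_mul_of_nonneg_left (hmax _ hx _ hk₁ _ hz) ht.le
    have b₂ := mul_le_mul_of_nonneg_left (hmax _ hx _ hk₂ _ hz) ht.le
    have b₃ := mul_le_mul_of_nonneg_left (hmax _ hx _ hk₃ _ hz) ht.le
    have c₁ := mul_le_mul_of_nonneg_left (hmax _ hx _ hy _ hk₁) ht.le
    have c₂ := mul_le_mul_of_nonneg_left (hmax _ hx _ hy _ hk₂) ht.le
    have c₃ := mul_le_mul_of_nonneg_left (hmax _ hx _ hy _ hk₃) ht.le
    have d₁ := mul_nonpos_of_nonneg_of_nonpos ht.le h₁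
    have d₂ := mul_nonpos_of_nonneg_of_nonpos ht.le h₂
    have d₃ := mul_nonpos_of_nonneg_of_nonpos ht.le h₃
    have f₁ := mul_pos hs hD
    have f₂ := mul_pos ht hD
    have f₃ := mul_pos (sub_pos.2 hst) hD
    fin_cases i <;> simp [-Complex.real_smul, P, a, b, c, e₁, e₂, e₃, z₁, z₂, z₃, ← hDdef] <;>
      refine ⟨?_, ?_, ?_⟩ <;> linarith
  have hdisj : Pairwise fun i j => Disjoint (openTriangle (a i) (b i - a i) (c i - a i))
      (openTriangle (a j) (b j - a j) (c j - a j)) := by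
    intro i j hij
    rw [Set.disjoint_left]
    intro p hi hj
    have hi := hP i p hi
    have hj := hP j p hj
    have := hsum p
    fin_cases i <;> fin_cases j <;> simp [P] at hij hi hj <;> linarith
  have hmem : ∀ i, a i ∈ K ∧ b i ∈ K ∧ c i ∈ K := by
    intro i; fin_cases i <;> simp [a, b, c, *]
  have key := sum_area_openTriangle_le hK.2.1.measure_lt_top.ne a (fun i => b i - a i)
    (fun i => c i - a i)
    (fun i => hK.1.openTriangle_subset (hmem i).1 (hmem i).2.1 (hmem i).2.2) hdisj
  refine le_trans (le_of_eq ?_) key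
  have r₁ : cross (z - y) (k₁ - y) = signedArea k₁ y z := by simp [signedArea, cross]; ring
  have r₂ : cross (x - z) (k₂ - z) = signedArea x k₂ z := by simp [signedArea, cross]; ring
  have r₃ : cross (y - x) (k₃ - x) = signedArea x y k₃ := rfl
  have r₀ : cross (y - x) (z - x) = D := rfl
  simp [Fin.sum_univ_four, a, b, c, r₀, r₁, r₂, r₃, abs_of_pos hD, abs_of_nonpos h₁,
    abs_of_nonpos h₂, abs_of_nonpos h₃]
  ring

lemma openTriangle_subset_polarBody {C : Set ℂ} {u v : ℂ} (hu : ∀ y ∈ C, ⟪u, y⟫ ≤ 1)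
    (hv : ∀ y ∈ C, ⟪v, y⟫ ≤ 1) : openTriangle 0 u v ⊆ polarBody C := by
  rintro _ ⟨s, t, hs, ht, hst, rfl⟩ y hy
  rw [zero_add, inner_add_left, real_inner_smul_left, real_inner_smul_left]
  nlinarith [hu y hy, hv y hy]

lemma inner_pos_of_mem_openTriangle {u v e p : ℂ} (hp : p ∈ openTriangle 0 u v)
    (hu : 0 ≤ ⟪u, e⟫) (hv : 0 ≤ ⟪v, e⟫) (huv : 0 < ⟪u, e⟫ + ⟪v, e⟫) : 0 < ⟪p, e⟫ := by
  obtain ⟨s, t, hs, ht, -, rfl⟩ := hp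
  rw [zero_add, inner_add_left, real_inner_smul_left, real_inner_smul_left]
  rcases hu.eq_or_lt with h | h
  · rw [← h] at huv ⊢
    nlinarith
  · nlinarith [mul_pos hs h, mul_nonneg ht.le hv]

lemma inner_neg_of_mem_openTriangle {u v e p : ℂ} (hp : p ∈ openTriangle 0 u v)
    (hu : ⟪u, e⟫ ≤ 0) (hv : ⟪v, e⟫ ≤ 0) (huv : ⟪u, e⟫ + ⟪v, e⟫ < 0) : ⟪p, e⟫ < 0 := by
  have := inner_pos_of_mem_openTriangle (e := -e) hp
    (by rw [inner_neg_right]; linarith) (by rw [inner_neg_right]; linarith)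
    (by rw [inner_neg_right, inner_neg_right]; linarith)
  rw [inner_neg_right] at this
  linarith

/-- If the area coordinates of `K` with respect to a triangle `xyz` of doubled area `D` range in
intervals of lengths at most `W₁`, `W₂`, `W₃`, the polar of `(K - K) / 2` contains a hexagon. -/
lemma le_area_polarBody {K : Set ℂ} (hK : IsConvexBody K) {x y z : ℂ} {W₁ W₂ W₃ : ℝ}
    (hD : 0 < signedArea x y z) (hW₁ : 0 < W₁) (hW₂ : 0 < W₂) (hW₃ : 0 < W₃)
    (h₁ : ∀ p ∈ K, ∀ q ∈ K, signedArea p y z - signedArea q y z ≤ W₁)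
    (h₂ : ∀ p ∈ K, ∀ q ∈ K, signedArea x p z - signedArea x q z ≤ W₂)
    (h₃ : ∀ p ∈ K, ∀ q ∈ K, signedArea x y p - signedArea x y q ≤ W₃) :
    4 * signedArea x y z * (1 / (W₁ * W₂) + 1 / (W₂ * W₃) + 1 / (W₁ * W₃)) ≤
      area (polarBody ((2⁻¹ : ℝ) • (K - K))) := by
  set D := signedArea x y z with hDdef
  set g₁ := crossDual (W₁ / 2) (z - y) with hg₁
  set g₂ := crossDual (W₂ / 2) (x - z) with hg₂
  set g₃ := crossDual (W₃ / 2) (y - x) with hg₃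
  have c₁₂ : cross (z - y) (x - z) = D := by simp [hDdef, signedArea, cross]; ring
  have c₂₃ : cross (x - z) (y - x) = D := by simp [hDdef, signedArea, cross]; ring
  have c₃₁ : cross (y - x) (z - y) = D := by simp [hDdef, signedArea, cross]; ring
  have cc : ∀ u, cross u u = 0 := by intro u; simp [cross]; ring
  -- each of `g₁`, `g₂`, `g₃` lies in the polar body together with its opposite
  have bound : ∀ (W : ℝ) (e : ℂ) (f : ℂ → ℝ), 0 < W → (∀ p q, cross e (p - q) = f p - f q) →
      (∀ p ∈ K, ∀ q ∈ K, f p - f q ≤ W) → ∀ v ∈ (2⁻¹ : ℝ) • (K - K),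
      ⟪crossDual (W / 2) e, v⟫ ≤ 1 ∧ ⟪-crossDual (W / 2) e, v⟫ ≤ 1 := by
    rintro W e f hW hf hle _ ⟨_, ⟨p, hp, q, hq, rfl⟩, rfl⟩
    have hpq := hle p hp q hq
    have hqp := hle q hq p hp
    have : ⟪crossDual (W / 2) e, (2⁻¹ : ℝ) • (p - q)⟫ = (f p - f q) / W := by
      rw [real_inner_smul_right, inner_crossDual, hf]; field_simp
    simp only [inner_neg_left, this, ← neg_div, div_le_one hW]
    constructor <;> linarith
  have b₁ := bound W₁ (z - y) (fun p => signedArea p y z) hW₁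
    (by intro p q; simp [signedArea, cross]; ring) h₁
  have b₂ := bound W₂ (x - z) (fun p => signedArea x p z) hW₂
    (by intro p q; simp [signedArea, cross]; ring) h₂
  have b₃ := bound W₃ (y - x) (fun p => signedArea x y p) hW₃
    (by intro p q; simp [signedArea, cross]; ring) h₃
  let u : Fin 6 → ℂ := ![g₁, -g₃, g₂, -g₁, g₃, -g₂]
  let v : Fin 6 → ℂ := ![-g₃, g₂, -g₁, g₃, -g₂, g₁]
  have hsub : ∀ i, openTriangle 0 (u i) (v i) ⊆ polarBody ((2⁻¹ : ℝ) • (K - K)) := by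
    intro i
    apply openTriangle_subset_polarBody <;> intro w hw <;> have B₁ := b₁ w hw <;>
      have B₂ := b₂ w hw <;> have B₃ := b₃ w hw <;> fin_cases i <;>
      first | exact B₁.1 | exact B₁.2 | exact B₂.1 | exact B₂.2 | exact B₃.1 | exact B₃.2
  have i₁₁ : ⟪g₁, z - y⟫ = 0 := by rw [hg₁, inner_crossDual, cc, zero_div]
  have i₂₂ : ⟪g₂, x - z⟫ = 0 := by rw [hg₂, inner_crossDual, cc, zero_div]
  have i₃₃ : ⟪g₃, y - x⟫ = 0 := by rw [hg₃, inner_crossDual, cc, zero_div]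
  have i₁₂ : 0 < ⟪g₁, x - z⟫ := by rw [hg₁, inner_crossDual, c₁₂]; positivity
  have i₂₃ : 0 < ⟪g₂, y - x⟫ := by rw [hg₂, inner_crossDual, c₂₃]; positivity
  have i₃₁ : 0 < ⟪g₃, z - y⟫ := by rw [hg₃, inner_crossDual, c₃₁]; positivity
  have i₂₁ : ⟪g₂, z - y⟫ < 0 := by
    rw [hg₂, inner_crossDual, cross_swap, c₁₂, neg_div, neg_lt_zero]; positivity
  have i₃₂ : ⟪g₃, x - z⟫ < 0 := by
    rw [hg₃, inner_crossDual, cross_swap, c₂₃, neg_div, neg_lt_zero]; positivity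
  have i₁₃ : ⟪g₁, y - x⟫ < 0 := by
    rw [hg₁, inner_crossDual, cross_swap, c₃₁, neg_div, neg_lt_zero]; positivity
  let P : Fin 6 → ℂ → Prop := ![
    fun p => ⟪p, z - y⟫ < 0 ∧ 0 < ⟪p, x - z⟫ ∧ ⟪p, y - x⟫ < 0,
    fun p => ⟪p, z - y⟫ < 0 ∧ 0 < ⟪p, x - z⟫ ∧ 0 < ⟪p, y - x⟫,
    fun p => ⟪p, z - y⟫ < 0 ∧ ⟪p, x - z⟫ < 0 ∧ 0 < ⟪p, y - x⟫,
    fun p => 0 < ⟪p, z - y⟫ ∧ ⟪p, x - z⟫ < 0 ∧ 0 < ⟪p, y - x⟫,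
    fun p => 0 < ⟪p, z - y⟫ ∧ ⟪p, x - z⟫ < 0 ∧ ⟪p, y - x⟫ < 0,
    fun p => 0 < ⟪p, z - y⟫ ∧ 0 < ⟪p, x - z⟫ ∧ ⟪p, y - x⟫ < 0]
  have hP : ∀ i, ∀ p ∈ openTriangle 0 (u i) (v i), P i p := by
    intro i p hp
    fin_cases i <;> refine ⟨?_, ?_, ?_⟩ <;>
      first
      | (refine inner_pos_of_mem_openTriangle hp ?_ ?_ ?_ <;>
          simp only [u, v, Fin.mk_zero, Fin.mk_one, Fin.reduceFinMk, Matrix.cons_val,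
            Matrix.cons_val_zero, Matrix.cons_val_one, inner_neg_left] <;> linarith)
      | (refine inner_neg_of_mem_openTriangle hp ?_ ?_ ?_ <;>
          simp only [u, v, Fin.mk_zero, Fin.mk_one, Fin.reduceFinMk, Matrix.cons_val,
            Matrix.cons_val_zero, Matrix.cons_val_one, inner_neg_left] <;> linarith)
  have hdisj : Pairwise fun i j =>
      Disjoint (openTriangle 0 (u i) (v i)) (openTriangle 0 (u j) (v j)) := by
    intro i j hij
    rw [Set.disjoint_left]
    intro p hi hj
    have hi := hP i p hi
    have hj := hP j p hj
    fin_cases i <;> fin_cases j <;> first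
      | exact hij rfl
      | exact lt_asymm hi.1 hj.1
      | exact lt_asymm hi.2.1 hj.2.1
      | exact lt_asymm hi.2.2 hj.2.2
  have key := sum_area_openTriangle_le (volume_polarBody_ne_top_s11 hK) (fun _ : Fin 6 => (0 : ℂ))
    u v hsub hdisj
  refine le_trans (le_of_eq ?_) key
  have r₁₂ : cross g₁ g₂ = D / (W₁ / 2 * (W₂ / 2)) := by rw [hg₁, hg₂, cross_crossDual, c₁₂]
  have r₂₃ : cross g₂ g₃ = D / (W₂ / 2 * (W₃ / 2)) := by rw [hg₂, hg₃, cross_crossDual, c₂₃]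
  have r₃₁ : cross g₃ g₁ = D / (W₃ / 2 * (W₁ / 2)) := by rw [hg₃, hg₁, cross_crossDual, c₃₁]
  simp only [Fin.sum_univ_six, u, v, Matrix.cons_val, Matrix.cons_val_zero, Matrix.cons_val_one,
    cross_neg_left, cross_neg_right, abs_neg, cross_swap g₁ g₂, cross_swap g₂ g₃,
    cross_swap g₃ g₁, r₁₂, r₂₃, r₃₁]
  rw [abs_of_pos (show 0 < D / (W₁ / 2 * (W₂ / 2)) by positivity),
    abs_of_pos (show 0 < D / (W₂ / 2 * (W₃ / 2)) by positivity),
    abs_of_pos (show 0 < D / (W₃ / 2 * (W₁ / 2)) by positivity)]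
  field_simp
  ring

lemma distBM_le {K L : Set ℂ} {l₁ l₂ : ℝ} (A : ℂ ≃ᵃ[ℝ] ℂ) (x : ℂ) (h₁ : 0 < l₁) (h₂ : 0 < l₂)
    (hKL : l₁ • (A '' K) ⊆ L) (hLK : L ⊆ x +ᵥ l₂ • (A '' K)) : distBM K L ≤ l₂ / l₁ := by
  refine csInf_le ⟨0, ?_⟩ ⟨l₁, l₂, A, x, h₁, h₂, rfl, hKL, hLK⟩
  rintro _ ⟨m₁, m₂, -, -, hm₁, hm₂, rfl, -⟩
  positivity

lemma exists_linearEquiv_of_cross_ne_zero {u v u' v' : ℂ} (h : cross u v ≠ 0)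
    (h' : cross u' v' ≠ 0) : ∃ L : ℂ ≃ₗ[ℝ] ℂ, L u = u' ∧ L v = v' := by
  have equiv : ∀ {u v : ℂ}, cross u v ≠ 0 →
      ∃ L : ℂ ≃ₗ[ℝ] ℂ, L 1 = u ∧ L Complex.I = v := by
    intro u v huv
    refine ⟨LinearEquiv.ofIsUnitDet (f := linOfImages u v)
      (v := Complex.basisOneI) (v' := Complex.basisOneI)
      (by rw [LinearMap.det_toMatrix, det_linOfImages]; exact huv.isUnit), ?_, ?_⟩ <;>
      simp [linOfImages_apply]
  obtain ⟨L, hu, hv⟩ := equiv h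
  obtain ⟨L', hu', hv'⟩ := equiv h'
  exact ⟨L.symm.trans L', by simp [← hu, hu'], by simp [← hv, hv']⟩

lemma cross_ne_zero_of_affineIndependent {a b c : ℂ} (h : AffineIndependent ℝ ![a, b, c]) :
    cross (b - a) (c - a) ≠ 0 := by
  intro h0
  have hlin := (affineIndependent_iff_linearIndependent_vsub ℝ _ (0 : Fin 3)).1 h
  rw [← linearIndependent_equiv (finSuccAboveEquiv (0 : Fin 3))] at hlin
  have hpair : ∀ s t : ℝ, s • (b - a) + t • (c - a) = 0 → s = 0 ∧ t = 0 := by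
    intro s t hst
    have hcoeff := Fintype.linearIndependent_iff.1 hlin ![s, t]
      (by rw [Fin.sum_univ_two]; exact hst)
    exact ⟨hcoeff 0, hcoeff 1⟩
  simp only [cross] at h0
  have key₁ := hpair (c - a).im (-(b - a).im) (by
    apply Complex.ext <;> simp at h0 ⊢ <;> linarith)
  have key₂ := hpair (c - a).re (-(b - a).re) (by
    apply Complex.ext <;> simp at h0 ⊢ <;> linarith)
  have hzero : c - a = 0 := Complex.ext key₂.1 key₁.1
  have := hpair 0 1 (by simp [hzero])
  exact one_ne_zero this.2

/-- A convex set between a triangle `xyz` and a homothetic copy of it is close to any triangle. -/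
lemma distBM_le_of_signedArea {K T : Set ℂ} (hK : Convex ℝ K) (hT : IsTriangle T) {x y z : ℂ}
    {m₁ m₂ m₃ : ℝ} (hx : x ∈ K) (hy : y ∈ K) (hz : z ∈ K) (hD : 0 < signedArea x y z)
    (h₁ : ∀ p ∈ K, -m₁ ≤ signedArea p y z) (h₂ : ∀ p ∈ K, -m₂ ≤ signedArea x p z)
    (h₃ : ∀ p ∈ K, -m₃ ≤ signedArea x y p) :
    distBM K T ≤ 1 + (m₁ + m₂ + m₃) / signedArea x y z := by
  obtain ⟨a, b, c, habc, rfl⟩ := hT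
  obtain ⟨L, hLy, hLz⟩ := exists_linearEquiv_of_cross_ne_zero (u := y - x) (v := z - x) hD.ne'
    (cross_ne_zero_of_affineIndependent habc)
  set D := signedArea x y z with hDdef
  have hm₁ : 0 ≤ m₁ := by
    have := h₁ y hy
    simp [signedArea, cross] at this
    exact this
  have hm₂ : 0 ≤ m₂ := by
    have := h₂ x hx
    simp [signedArea, cross] at this
    exact this
  have hm₃ : 0 ≤ m₃ := by
    have := h₃ x hx
    simp [signedArea, cross] at this
    exact this
  have hS : 0 < D + m₁ + m₂ + m₃ := by linarith
  have hsum : ∀ p, signedArea p y z + signedArea x p z + signedArea x y p = D := by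
    intro p; simp only [hDdef, signedArea, cross, Complex.sub_re, Complex.sub_im]; ring
  have hL : ∀ p, D • L (p - x) = signedArea x p z • (b - a) + signedArea x y p • (c - a) := by
    intro p
    rw [← hLy, ← hLz, ← map_smul, ← map_smul, ← map_smul, ← map_add]
    congr 1
    apply Complex.ext <;> simp [hDdef, signedArea, cross] <;> ring
  set d : ℂ := ((D + m₁ + m₂ + m₃) / D) • a + (m₂ / D) • (b - a) + (m₃ / D) • (c - a) with hd
  let A : ℂ ≃ᵃ[ℝ] ℂ := L.toAffineEquiv.trans (AffineEquiv.constVAdd ℝ ℂ (d - L x))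
  have hA : ∀ p, A p = d + L (p - x) := by
    intro p
    simp [A, map_sub]
    ring
  have key := distBM_le (K := K) (L := convexHull ℝ {a, b, c}) (l₁ := D / (D + m₁ + m₂ + m₃))
    (l₂ := 1) A (a - d) (by positivity) one_pos ?_ ?_
  · refine key.trans (le_of_eq ?_)
    field_simp
    ring
  · rintro _ ⟨_, ⟨p, hp, rfl⟩, rfl⟩
    have q₁ := h₁ p hp
    have q₂ := h₂ p hp
    have q₃ := h₃ p hp
    have hs := hsum p
    have hmem := (convex_convexHull ℝ {a, b, c}).sum_mem (t := Finset.univ)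
      (w := ![(signedArea p y z + m₁) / (D + m₁ + m₂ + m₃),
        (signedArea x p z + m₂) / (D + m₁ + m₂ + m₃),
        (signedArea x y p + m₃) / (D + m₁ + m₂ + m₃)]) (z := ![a, b, c])
      (by
        intro i _
        fin_cases i <;> exact div_nonneg (by linarith) hS.le)
      (by
        simp [Fin.sum_univ_three]
        field_simp
        linarith)
      (by
        intro i _
        fin_cases i <;> exact subset_convexHull ℝ _ (by simp))
    convert hmem using 1
    have hLp : L (p - x) = (signedArea x p z / D) • (b - a) + (signedArea x y p / D) • (c - a) := by
      rw [div_eq_inv_mul, div_eq_inv_mul, mul_smul, mul_smul, ← smul_add, ← hL,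
        inv_smul_smul₀ hD.ne']
    have hp₁ : signedArea p y z = D - signedArea x p z - signedArea x y p := by linarith
    simp only [hA, hLp, hd, Fin.sum_univ_three, Matrix.cons_val_zero, Matrix.cons_val_one,
      Matrix.cons_val, hp₁]
    have hS' := hS.ne'
    have hD' := hD.ne'
    apply Complex.ext <;> simp only [Complex.add_re, Complex.add_im, Complex.smul_re,
      Complex.smul_im, Complex.sub_re, Complex.sub_im, smul_eq_mul] <;> field_simp <;> ring
  · have himg : (a - d) +ᵥ (1 : ℝ) • (A '' K) = (fun p => a + L (p - x)) '' K := by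
      ext w
      simp only [one_smul, Set.mem_vadd_set, Set.mem_image, vadd_eq_add,
        exists_exists_and_eq_and, hA]
      refine exists_congr fun p => and_congr_right fun _ => ?_
      rw [← add_assoc, sub_add_cancel]
    refine convexHull_min ?_ ?_
    · rw [himg]
      rintro w (rfl | rfl | rfl)
      · exact ⟨x, hx, by simp⟩
      · exact ⟨y, hy, by simp [hLy]⟩
      · exact ⟨z, hz, by simp [hLz]⟩
    · exact ((hK.affine_image A.toAffineMap).smul 1).vadd (a - d)

/-- The final numerical estimate, with `a`, `b`, `c` the heights of the caps relative to those of
the triangle. -/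
lemma add_le_of_capHeights {a b c ε : ℝ} (ha : 0 ≤ a) (hb : 0 ≤ b) (hc : 0 ≤ c) (ha1 : a ≤ 1)
    (hb1 : b ≤ 1) (hc1 : c ≤ 1) (hab : 2 * (a * b) ≤ 1) (hε : 0 < ε)
    (h : 2 * (1 + a + b + c) * (3 + a + b + c) ≤ (1 + ε) * 6 * ((1 + a) * (1 + b) * (1 + c))) :
    a + b + c ≤ 87 * ε := by
  have hσ : a + b + c ≤ 5 / 2 := by nlinarith [mul_nonneg (sub_nonneg.2 ha1) (sub_nonneg.2 hb1)]
  have amgm : 27 * ((1 + a) * (1 + b) * (1 + c)) ≤ (3 + a + b + c) ^ 3 := by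
    nlinarith [mul_nonneg ha (sq_nonneg (b - c)), mul_nonneg hb (sq_nonneg (a - c)),
      mul_nonneg hc (sq_nonneg (a - b)), sq_nonneg (a - b), sq_nonneg (b - c), sq_nonneg (a - c),
      mul_nonneg ha (sq_nonneg (a - b)), mul_nonneg ha (sq_nonneg (a - c)),
      mul_nonneg hb (sq_nonneg (a - b)), mul_nonneg hb (sq_nonneg (b - c)),
      mul_nonneg hc (sq_nonneg (b - c)), mul_nonneg hc (sq_nonneg (a - c))]
  obtain ⟨s, hs⟩ : ∃ s, s = a + b + c := ⟨_, rfl⟩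
  have hs0 : 0 ≤ s := by rw [hs]; positivity
  rw [← hs] at hσ ⊢
  rw [show 1 + a + b + c = 1 + s by rw [hs]; ring, show 3 + a + b + c = 3 + s by rw [hs]; ring] at h
  rw [show 3 + a + b + c = 3 + s by rw [hs]; ring] at amgm
  have h3 : 0 < 3 + s := by linarith
  have h9 : 9 * (1 + s) ≤ (1 + ε) * (3 + s) ^ 2 := by
    refine le_of_mul_le_mul_right ?_ h3
    nlinarith [mul_le_mul_of_nonneg_left amgm (show 0 ≤ 1 + ε by linarith)]
  have hsq : (3 + s) ^ 2 ≤ 121 / 4 := by nlinarith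
  nlinarith [mul_le_mul_of_nonneg_left hsq hε.le, mul_nonneg hs0 (sub_nonneg.2 hσ)]

/-- Stability of the Eggleston inequality: if `|K|·|((K−K)/2)*| ≤ (1+ε)·6`, then
the Banach–Mazur distance of `K` from any triangle `T` is at most `1 + 87ε`. -/
theorem eggleston_stability (K T : Set ℂ) (hK : IsConvexBody K) (hT : IsTriangle T)
    (ε : ℝ) (hε : 0 < ε)
    (hvp : area K * area (polarBody ((2⁻¹ : ℝ) • (K - K))) ≤ (1 + ε) * 6) :
    distBM K T ≤ 1 + 87 * ε := by
  obtain ⟨x, hx, y, hy, z, hz, hD, hmax⟩ := exists_isMaxOn_signedArea hK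
  have c₁ : Continuous fun p => signedArea p y z :=
    continuous_signedArea.comp (by fun_prop : Continuous fun p : ℂ => (p, y, z))
  have c₂ : Continuous fun p => signedArea x p z :=
    continuous_signedArea.comp (by fun_prop : Continuous fun p : ℂ => (x, p, z))
  have c₃ : Continuous fun p => signedArea x y p :=
    continuous_signedArea.comp (by fun_prop : Continuous fun p : ℂ => (x, y, p))
  obtain ⟨k₁, hk₁, min₁⟩ := hK.2.1.exists_isMinOn ⟨x, hx⟩ c₁.continuousOn
  obtain ⟨k₂, hk₂, min₂⟩ := hK.2.1.exists_isMinOn ⟨x, hx⟩ c₂.continuousOn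
  obtain ⟨k₃, hk₃, min₃⟩ := hK.2.1.exists_isMinOn ⟨x, hx⟩ c₃.continuousOn
  have min₁ : ∀ p ∈ K, signedArea k₁ y z ≤ signedArea p y z := fun p hp => min₁ hp
  have min₂ : ∀ p ∈ K, signedArea x k₂ z ≤ signedArea x p z := fun p hp => min₂ hp
  have min₃ : ∀ p ∈ K, signedArea x y k₃ ≤ signedArea x y p := fun p hp => min₃ hp
  set D := signedArea x y z with hDdef
  have n₁ : signedArea k₁ y z ≤ 0 := (min₁ y hy).trans_eq (by simp [signedArea, cross])
  have n₂ : signedArea x k₂ z ≤ 0 := (min₂ x hx).trans_eq (by simp [signedArea, cross])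
  have n₃ : signedArea x y k₃ ≤ 0 := (min₃ x hx).trans_eq (by simp [signedArea, cross])
  have swap : ∀ p q r, signedArea p r q = -signedArea p q r := by
    intro p q r; simp [signedArea, cross]; ring
  have l₁ : -D ≤ signedArea k₁ y z := by
    linarith [hmax k₁ hk₁ z hz y hy, swap k₁ y z]
  have l₂ : -D ≤ signedArea x k₂ z := by
    linarith [hmax x hx z hz k₂ hk₂, swap x k₂ z]
  have l₃ : -D ≤ signedArea x y k₃ := by
    linarith [hmax x hx k₃ hk₃ y hy, swap x y k₃]
  have area_le := le_area_of_caps hK hx hy hz hk₁ hk₂ hk₃ hD hmax n₁ n₂ n₃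
  have polar_le := le_area_polarBody hK (W₁ := D - signedArea k₁ y z)
    (W₂ := D - signedArea x k₂ z) (W₃ := D - signedArea x y k₃) hD
    (by linarith) (by linarith) (by linarith)
    (fun p hp q hq => sub_le_sub (hmax p hp y hy z hz) (min₁ q hq))
    (fun p hp q hq => sub_le_sub (hmax x hx p hp z hz) (min₂ q hq))
    (fun p hp q hq => sub_le_sub (hmax x hx y hy p hp) (min₃ q hq))
  have dist_le := distBM_le_of_signedArea (m₁ := -signedArea k₁ y z) (m₂ := -signedArea x k₂ z)
    (m₃ := -signedArea x y k₃) hK.1 hT hx hy hz hD (by simpa using min₁) (by simpa using min₂)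
    (by simpa using min₃)
  rw [← hDdef] at area_le polar_le dist_le
  refine dist_le.trans (add_le_add_right ?_ 1)
  -- the triangle `x k₁ k₂` is not larger than `x y z`
  have hpq : D * signedArea x k₁ k₂ =
      signedArea x k₁ z * signedArea x y k₂ - signedArea x y k₁ * signedArea x k₂ z := by
    simp [hDdef, signedArea, cross]; ring
  have hsum : ∀ p, signedArea p y z + signedArea x p z + signedArea x y p = D := by
    intro p; simp only [hDdef, signedArea, cross, Complex.sub_re, Complex.sub_im]; ring
  have t₁ := hsum k₁
  have t₂ := hsum k₂
  have u₁ := hmax x hx k₁ hk₁ z hz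
  have u₂ := hmax x hx y hy k₁ hk₁
  have u₃ := hmax k₂ hk₂ y hy z hz
  have hxk := mul_le_mul_of_nonneg_left (hmax x hx k₁ hk₁ k₂ hk₂) hD.le
  rw [hpq] at hxk
  obtain ⟨a, ha⟩ : ∃ a, a = -signedArea k₁ y z / D := ⟨_, rfl⟩
  obtain ⟨b, hb⟩ : ∃ b, b = -signedArea x k₂ z / D := ⟨_, rfl⟩
  obtain ⟨c, hc⟩ : ∃ c, c = -signedArea x y k₃ / D := ⟨_, rfl⟩
  have ha' : signedArea k₁ y z = -(a * D) := by rw [ha]; field_simp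
  have hb' : signedArea x k₂ z = -(b * D) := by rw [hb]; field_simp
  have hc' : signedArea x y k₃ = -(c * D) := by rw [hc]; field_simp
  have ha0 : 0 ≤ a := by rw [ha]; exact div_nonneg (by linarith) hD.le
  have hb0 : 0 ≤ b := by rw [hb]; exact div_nonneg (by linarith) hD.le
  have hc0 : 0 ≤ c := by rw [hc]; exact div_nonneg (by linarith) hD.le
  have ha1 : a ≤ 1 := by rw [ha, div_le_one hD]; linarith
  have hb1 : b ≤ 1 := by rw [hb, div_le_one hD]; linarith
  have hc1 : c ≤ 1 := by rw [hc, div_le_one hD]; linarith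
  rw [ha', hb', hc'] at area_le polar_le ⊢
  simp only [sub_neg_eq_add] at area_le polar_le
  have hab : 2 * (a * b) ≤ 1 := by
    have v₁ : a * D ≤ signedArea x k₁ z := by linarith
    have v₂ : b * D ≤ signedArea x y k₂ := by linarith
    have v₃ : a * D ≤ signedArea x y k₁ := by linarith
    have w₁ := mul_le_mul v₁ v₂ (by positivity) ((by positivity : 0 ≤ a * D).trans v₁)
    have w₂ := mul_le_mul_of_nonneg_right v₃ (by positivity : 0 ≤ b * D)
    rw [hb'] at hxk
    refine le_of_mul_le_mul_right ?_ (mul_pos hD hD)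
    linarith
  have hfin : 2 * (1 + a + b + c) * (3 + a + b + c) ≤
      (1 + ε) * 6 * ((1 + a) * (1 + b) * (1 + c)) := by
    have hprod := (mul_le_mul area_le polar_le (by positivity)
      (ENNReal.toReal_nonneg)).trans hvp
    have e : (D + a * D + b * D + c * D) / 2 * (4 * D *
        (1 / ((D + a * D) * (D + b * D)) + 1 / ((D + b * D) * (D + c * D)) +
          1 / ((D + a * D) * (D + c * D)))) =
        2 * (1 + a + b + c) * (3 + a + b + c) / ((1 + a) * (1 + b) * (1 + c)) := by
      rw [show D + a * D = D * (1 + a) by ring, show D + b * D = D * (1 + b) by ring,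
        show D + c * D = D * (1 + c) by ring]
      field_simp
      ring
    rw [e, div_le_iff₀ (by positivity)] at hprod
    exact hprod
  have := add_le_of_capHeights ha0 hb0 hc0 ha1 hb1 hc1 hab hε hfin
  refine le_trans (le_of_eq ?_) this
  field_simp
end
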